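/- Let (k_i)_{i≥1} be an eventually periodic sequence of positive integers satisfying condition (★). Then the subshift (X,σ) is uniquely ergodic and, with μ its unique σ-invariant Borel probability measure, the system (X,σ,μ) is weakly mixing: for every c ∈ ℂ and every μ-measurable function f : X → ℂ which is not μ-a.e. equal to 0 and satisfies f∘σ = c·f μ-a.e., f is constant μ-a.e. (and consequently c = 1). -/

import Mathlib

open Filter Topology MeasureTheory

/-- The substitution `χ_k` on the alphabet `{1,2,3}`, coded as `Fin 3 = {0,1,2}`
(letter 1 ↦ 0, letter 2 ↦ 1, letter 3 ↦ 2):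
`χ_k(1) = 2`, `χ_k(2) = 3 1^k`, `χ_k(3) = 3 1^(k-1)`. -/
def chiSub (k : ℕ) : Fin 3 → List (Fin 3) :=
  ![[1], 2 :: List.replicate k 0, 2 :: List.replicate (k - 1) 0]

/-- Extension of `χ_k` to finite words by concatenation. -/
def applyChi (k : ℕ) (w : List (Fin 3)) : List (Fin 3) := w.flatMap (chiSub k)

/-- `compApply k n w = χ_{k 1} ∘ χ_{k 2} ∘ ⋯ ∘ χ_{k n} (w)`. -/
def compApply (k : ℕ → ℕ) : ℕ → List (Fin 3) → List (Fin 3)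
  | 0, w => w
  | n + 1, w => compApply k n (applyChi (k (n + 1)) w)

/-- Condition (★): k_{2i} > 1` for infinitely many `i` and `k_{2i-1} > 1`
for infinitely many `i`. -/
def StarCond (k : ℕ → ℕ) : Prop :=
  (∀ N, ∃ i ≥ N, 1 < k (2 * i)) ∧ (∀ N, ∃ i ≥ N, 1 < k (2 * i - 1))

/-- `w` is a prefix of the infinite sequence `x`. -/
def IsPrefixSeq (w : List (Fin 3)) (x : ℕ → Fin 3) : Prop :=
  w = List.ofFn fun i : Fin w.length => x i

/-- The left shift `σ`. -/
def shift (x : ℕ → Fin 3) : ℕ → Fin 3 := fun i => x (i + 1)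

/-- The closure of the `σ`-orbit of `ρ`: the subshift `X`. -/
def orbitClosure (ρ : ℕ → Fin 3) : Set (ℕ → Fin 3) :=
  closure {y | ∃ n : ℕ, y = fun i => ρ (i + n)}

/-- A `σ`-invariant Borel probability measure on `X`, encoded as a measure on the full
product space giving `X` full mass. -/
def IsInvProb (X : Set (ℕ → Fin 3)) (μ : Measure (ℕ → Fin 3)) : Prop :=
  IsProbabilityMeasure μ ∧ μ Xᶜ = 0 ∧ μ.map shift = μ

/-- The length of the level-`n` word `χ_{k 1} ∘ ⋯ ∘ χ_{k n} (a)`. -/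
def wlen (k : ℕ → ℕ) (n : ℕ) (a : Fin 3) : ℕ := (compApply k n [a]).length

/-- The sequence `ρ` reads the word `w` at position `s`. -/
def Reads (ρ : ℕ → Fin 3) (w : List (Fin 3)) (s : ℕ) : Prop :=
  ∀ i (h : i < w.length), ρ (s + i) = w[i]

/-- The letter `a` occurs in `χ_{k (n+1)} ∘ ⋯ ∘ χ_{k (n+l)} (b)`. -/
def Reach (k : ℕ → ℕ) (n l : ℕ) (b a : Fin 3) : Prop :=
  a ∈ compApply (fun i => k (n + i)) l [b]

section Words

variable {k : ℕ → ℕ}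

lemma compApply_append (k : ℕ → ℕ) (n : ℕ) (u v : List (Fin 3)) :
    compApply k n (u ++ v) = compApply k n u ++ compApply k n v := by
  induction n generalizing u v with
  | zero => rfl
  | succ n ih => simp only [compApply, applyChi, List.flatMap_append, ih]

lemma compApply_nil (k : ℕ → ℕ) (n : ℕ) : compApply k n [] = [] := by
  induction n with
  | zero => rfl
  | succ n ih => simpa only [compApply, applyChi, List.flatMap_nil] using ih

lemma compApply_eq_flatMap (k : ℕ → ℕ) (n : ℕ) (w : List (Fin 3)) :
    compApply k n w = w.flatMap fun a => compApply k n [a] := by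
  induction w with
  | nil => simp [compApply_nil]
  | cons a w ih => rw [← List.singleton_append, compApply_append, ih]; simp

lemma compApply_add (k : ℕ → ℕ) (n l : ℕ) (w : List (Fin 3)) :
    compApply k (n + l) w = compApply k n (compApply (fun i => k (n + i)) l w) := by
  induction l generalizing w with
  | zero => rfl
  | succ l ih => rw [← add_assoc]; simp only [compApply, ih]; rfl

lemma compApply_singleton_succ (k : ℕ → ℕ) (n : ℕ) (a : Fin 3) :
    compApply k (n + 1) [a] = compApply k n (chiSub (k (n + 1)) a) := by
  simp [compApply, applyChi]

lemma length_compApply_replicate_zero (k : ℕ → ℕ) (n m : ℕ) :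
    (compApply k n (List.replicate m 0)).length = m * wlen k n 0 := by
  induction m with
  | zero => simp [compApply_nil]
  | succ m ih =>
    rw [List.replicate_succ, ← List.singleton_append, compApply_append, List.length_append, ih,
      wlen]
    ring

lemma wlen_succ_zero (k : ℕ → ℕ) (n : ℕ) : wlen k (n + 1) 0 = wlen k n 1 := by
  rw [wlen, compApply_singleton_succ]; rfl

lemma wlen_succ_one (k : ℕ → ℕ) (n : ℕ) :
    wlen k (n + 1) 1 = wlen k n 2 + k (n + 1) * wlen k n 0 := by
  rw [wlen, compApply_singleton_succ, ← length_compApply_replicate_zero, wlen,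
    ← List.length_append, ← compApply_append]; rfl

lemma wlen_succ_two (k : ℕ → ℕ) (n : ℕ) :
    wlen k (n + 1) 2 = wlen k n 2 + (k (n + 1) - 1) * wlen k n 0 := by
  rw [wlen, compApply_singleton_succ, ← length_compApply_replicate_zero, wlen,
    ← List.length_append, ← compApply_append]; rfl

lemma wlen_pos (k : ℕ → ℕ) (n : ℕ) (a : Fin 3) : 0 < wlen k n a := by
  induction n generalizing a with
  | zero => simp [wlen, compApply]
  | succ n ih =>
    fin_cases a
    · exact (wlen_succ_zero k n) ▸ ih 1
    · exact (wlen_succ_one k n) ▸ Nat.add_pos_left (ih 2) _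
    · exact (wlen_succ_two k n) ▸ Nat.add_pos_left (ih 2) _

lemma length_compApply_cons (k : ℕ → ℕ) (n : ℕ) (a : Fin 3) (v : List (Fin 3)) :
    (compApply k n (a :: v)).length = wlen k n a + (compApply k n v).length := by
  rw [← List.singleton_append, compApply_append, List.length_append, wlen]

lemma wlen_le_of_mem {n : ℕ} {a : Fin 3} {v : List (Fin 3)} (h : a ∈ v) :
    wlen k n a ≤ (compApply k n v).length := by
  obtain ⟨u, w, rfl⟩ := List.append_of_mem h
  rw [compApply_append, List.length_append, length_compApply_cons]
  omega

lemma Reach.wlen_le {n l : ℕ} {a b : Fin 3} (h : Reach k n l b a) :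
    wlen k n a ≤ wlen k (n + l) b := by
  rw [wlen.eq_1 k (n + l), compApply_add]
  exact wlen_le_of_mem h

lemma Reach.trans {n l l' : ℕ} {a b c : Fin 3} (h' : Reach k (n + l) l' c b)
    (h : Reach k n l b a) : Reach k n (l + l') c a := by
  unfold Reach at *
  rw [compApply_add, compApply_eq_flatMap, List.mem_flatMap]
  refine ⟨b, ?_, h⟩
  simpa only [add_assoc] using h'

lemma reach_one {n : ℕ} {a b : Fin 3} (h : a ∈ chiSub (k (n + 1)) b) : Reach k n 1 b a := by
  simpa [Reach, compApply, applyChi] using h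

lemma reach_zero (k : ℕ → ℕ) (n : ℕ) (a : Fin 3) : Reach k n 0 a a := by
  simp [Reach, compApply]

lemma reach_two_two (k : ℕ → ℕ) (n l : ℕ) : Reach k n l 2 2 := by
  induction l with
  | zero => exact reach_zero k n 2
  | succ l ih => exact Reach.trans (reach_one (by simp [chiSub])) ih

lemma reach_two (k : ℕ → ℕ) (n l : ℕ) (b : Fin 3) : Reach k n (l + 2) b 2 := by
  have h1 : Reach k (n + l) 1 1 2 := reach_one (by simp [chiSub])
  fin_cases b
  · exact Reach.trans (l' := 2) (b := 2)
      (Reach.trans (l := 1) (b := 1) (reach_one (by simp [chiSub])) h1) (reach_two_two k n l)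
  · exact Reach.trans (l' := 2) (b := 2)
      (Reach.trans (l := 1) (b := 2) (reach_one (by simp [chiSub])) (reach_two_two k _ 1))
      (reach_two_two k n l)
  · exact reach_two_two k n _

lemma reach_zero_zero (hpos : ∀ i, 1 ≤ i → 1 ≤ k i) (n j : ℕ) : Reach k n (2 * j) 0 0 := by
  induction j with
  | zero => exact reach_zero k n 0
  | succ j ih =>
    have h := hpos (n + 2 * j + 1) (by omega)
    refine Reach.trans (l := 2 * j) (l' := 2) (b := 0) ?_ ih
    refine Reach.trans (l := 1) (b := 1) (reach_one ?_) (reach_one ?_)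
    · simp [chiSub]
    · simp [chiSub]; omega

lemma reach_two_zero (hpos : ∀ i, 1 ≤ i → 1 ≤ k i) (n j : ℕ) (h : 1 < k (n + 2 * j + 1)) :
    Reach k n (2 * j + 1) 2 0 := by
  refine Reach.trans (b := 0) (reach_one ?_) (reach_zero_zero hpos n j)
  simp [chiSub]; omega

lemma reach_zero_of_gap (hpos : ∀ i, 1 ≤ i → 1 ≤ k i) {P n1 : ℕ}
    (hgap : ∀ n ≥ n1, ∃ j < P, 1 < k (n + 2 * j + 1)) {n l : ℕ} (hn : n1 ≤ n)
    (hl : 2 * P + 3 ≤ l) (b : Fin 3) : Reach k n l b 0 := by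
  obtain ⟨j, hj, hk⟩ := hgap n hn
  obtain ⟨d, rfl⟩ : ∃ d, l = (2 * j + 1) + (d + 2) := ⟨l - (2 * j + 3), by omega⟩
  exact Reach.trans (reach_two _ _ _ _) (reach_two_zero hpos n j hk)

lemma reach_all (hpos : ∀ i, 1 ≤ i → 1 ≤ k i) {P n1 : ℕ}
    (hgap : ∀ n ≥ n1, ∃ j < P, 1 < k (n + 2 * j + 1)) {n l : ℕ} (hn : n1 ≤ n)
    (hl : 2 * P + 4 ≤ l) (a b : Fin 3) : Reach k n l b a := by
  fin_cases a
  · exact reach_zero_of_gap hpos hgap hn (by omega) b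
  · obtain ⟨d, rfl⟩ : ∃ d, l = 1 + d := ⟨l - 1, by omega⟩
    exact Reach.trans (reach_zero_of_gap hpos hgap (by omega : n1 ≤ n + 1) (by omega) b)
      (reach_one (by simp [chiSub]))
  · obtain ⟨d, rfl⟩ : ∃ d, l = d + 2 := ⟨l - 2, by omega⟩
    exact reach_two k n d b

lemma eq_add_mul_of_periodic {m p : ℕ} (hper : ∀ i, m ≤ i → k (i + p) = k i) {i : ℕ} (hi : m ≤ i)
    (j : ℕ) : k (i + p * j) = k i := by
  induction j with
  | zero => rfl
  | succ j ih => rw [mul_add, mul_one, ← add_assoc, hper _ (by omega), ih]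

lemma exists_gap (hstar : StarCond k) {m p : ℕ} (hp : 1 ≤ p)
    (hper : ∀ i, m ≤ i → k (i + p) = k i) :
    ∀ n ≥ m, ∃ j < p, 1 < k (n + 2 * j + 1) := by
  intro n hn
  obtain ⟨j0, hj0⟩ : ∃ j0, 1 < k (n + 2 * j0 + 1) := by
    rcases Nat.even_or_odd' n with ⟨t, rfl | rfl⟩
    · obtain ⟨i, hi, hk⟩ := hstar.2 (t + 1)
      refine ⟨i - (t + 1), ?_⟩
      convert hk using 2; omega
    · obtain ⟨i, hi, hk⟩ := hstar.1 (t + 1)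
      refine ⟨i - (t + 1), ?_⟩
      convert hk using 2; omega
  refine ⟨j0 % p, Nat.mod_lt _ hp, ?_⟩
  have h := eq_add_mul_of_periodic hper (i := n + 2 * (j0 % p) + 1) (by omega) (2 * (j0 / p))
  rw [← h]
  convert hj0 using 2
  have := Nat.mod_add_div j0 p
  nlinarith

lemma exists_bound_of_periodic {m p : ℕ} (hp : 1 ≤ p) (hper : ∀ i, m ≤ i → k (i + p) = k i) :
    ∃ B, ∀ i, k i ≤ B := by
  refine ⟨∑ i ∈ Finset.range (m + p), k i, fun i => ?_⟩
  have key : ∀ i < m + p, k i ≤ ∑ i ∈ Finset.range (m + p), k i := fun i hi =>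
    Finset.single_le_sum (f := k) (fun _ _ => Nat.zero_le _) (Finset.mem_range.2 hi)
  by_cases hi : i < m
  · exact key i (by omega)
  · have h := eq_add_mul_of_periodic hper (i := m + (i - m) % p) (by omega) ((i - m) / p)
    have h1 := Nat.mod_add_div (i - m) p
    have h2 := Nat.mod_lt (i - m) hp
    rw [show m + (i - m) % p + p * ((i - m) / p) = i by omega] at h
    rw [h]
    exact key _ (by omega)

lemma wlen_add_le {B : ℕ} (hB : ∀ i, k i ≤ B) {n H : ℕ} (hH : ∀ b, wlen k n b ≤ H) (l : ℕ) :
    ∀ b, wlen k (n + l) b ≤ (B + 1) ^ l * H := by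
  induction l with
  | zero => simpa using hH
  | succ l ih =>
    intro b
    have e : (B + 1) ^ (l + 1) * H = (B + 1) ^ l * H + B * ((B + 1) ^ l * H) := by ring
    rw [e, ← add_assoc]
    set Q := (B + 1) ^ l * H
    have h0 := ih 0
    fin_cases b
    · exact (wlen_succ_zero k _).le.trans ((ih 1).trans (by omega))
    · refine (wlen_succ_one k _).le.trans (Nat.add_le_add (ih 2) (Nat.mul_le_mul (hB _) h0))
    · refine (wlen_succ_two k _).le.trans (Nat.add_le_add (ih 2) (Nat.mul_le_mul ?_ h0))
      exact (Nat.sub_le _ _).trans (hB _)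

lemma exists_wlen_add_le {B q n1 : ℕ} (hB : ∀ i, k i ≤ B)
    (hq : ∀ n ≥ n1, ∀ a b, Reach k n q b a) (l : ℕ) :
    ∃ C, ∀ n ≥ n1 + q, ∀ a b, wlen k (n + l) b ≤ C * wlen k n a := by
  refine ⟨(B + 1) ^ (q + l), fun n hn a b => ?_⟩
  obtain ⟨d, rfl⟩ : ∃ d, n = d + q := ⟨n - q, by omega⟩
  rw [add_assoc]
  exact wlen_add_le hB (fun c => (hq d (by omega) c a).wlen_le) _ b

lemma tendsto_wlen_two (hpos : ∀ i, 1 ≤ i → 1 ≤ k i) {q n1 : ℕ}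
    (hq : ∀ n ≥ n1, ∀ a b, Reach k n q b a) (j : ℕ) :
    ∀ n ≥ n1 + (q + 1) * j, j ≤ wlen k n 2 := by
  induction j with
  | zero => simp
  | succ j ih =>
    intro n hn
    rw [mul_add, mul_one] at hn
    obtain ⟨d, rfl⟩ : ∃ d, n = d + 1 + q := ⟨n - (q + 1), by omega⟩
    have h1 := ih d (by omega)
    have h2 := (hq (d + 1) (by nlinarith) 1 2).wlen_le
    rw [wlen_succ_one] at h2
    have h3 := Nat.mul_pos (hpos (d + 1) (by omega)) (wlen_pos k d 0)
    omega

lemma eventually_le_wlen (hpos : ∀ i, 1 ≤ i → 1 ≤ k i) {q n1 : ℕ}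
    (hq : ∀ n ≥ n1, ∀ a b, Reach k n q b a) (j : ℕ) :
    ∃ N, ∀ n ≥ N, ∀ a, j ≤ wlen k n a := by
  refine ⟨n1 + (q + 1) * j + q, fun n hn a => ?_⟩
  obtain ⟨d, rfl⟩ : ∃ d, n = d + q := ⟨n - q, by omega⟩
  exact (tendsto_wlen_two hpos hq j d (by omega)).trans
    (hq d (by nlinarith) 2 a).wlen_le

end Words

section Parsing

variable {k : ℕ → ℕ} {ρ : ℕ → Fin 3}

lemma reads_append {u v : List (Fin 3)} {s : ℕ} :
    Reads ρ (u ++ v) s ↔ Reads ρ u s ∧ Reads ρ v (s + u.length) := by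
  constructor
  · intro h
    refine ⟨fun i hi => ?_, fun i hi => ?_⟩
    · rw [h i (by simp; omega), List.getElem_append_left hi]
    · rw [add_assoc, h (u.length + i) (by simp; omega)]
      simp
  · rintro ⟨h1, h2⟩ i hi
    by_cases hu : i < u.length
    · rw [List.getElem_append_left hu, h1 i hu]
    · rw [List.getElem_append_right (by omega), ← h2 (i - u.length) (by simp at hi; omega)]
      congr 1; omega

lemma reads_of_isPrefixSeq {w : List (Fin 3)} (h : IsPrefixSeq w ρ) : Reads ρ w 0 := by
  intro i hi
  have : w[i] = (List.ofFn fun i : Fin w.length => ρ i)[i]'(by simpa using hi) := by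
    congr 1
  rw [this]; simp

lemma exists_split {n H : ℕ} (hH : ∀ b, wlen k n b ≤ H) (v : List (Fin 3)) (s : ℕ)
    (hs : s ≤ (compApply k n v).length) :
    ∃ u w, v = u ++ w ∧ s ≤ (compApply k n u).length ∧ (compApply k n u).length ≤ s + H := by
  induction v generalizing s with
  | nil => exact ⟨[], [], rfl, hs, by simp [compApply_nil]⟩
  | cons a v ih =>
    by_cases h0 : s = 0
    · exact ⟨[], a :: v, rfl, by simp [h0], by simp [compApply_nil]⟩
    rw [length_compApply_cons] at hs
    have := hH a
    obtain ⟨u, w, rfl, h1, h2⟩ := ih (s - wlen k n a) (by omega)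
    by_cases hsa : s ≤ wlen k n a
    · refine ⟨[a], u ++ w, rfl, hsa, ?_⟩
      exact this.trans (by omega)
    · refine ⟨a :: u, w, rfl, ?_, ?_⟩ <;> rw [length_compApply_cons] <;> omega

lemma exists_parse (hρ : ∀ n, IsPrefixSeq (compApply k n [2]) ρ)
    (hlen : ∀ j, ∃ N, ∀ n ≥ N, ∀ a, j ≤ wlen k n a) {n H : ℕ} (hH : ∀ b, wlen k n b ≤ H)
    (s N : ℕ) (hN : 2 * H ≤ N) :
    ∃ s' v, s ≤ s' ∧ s' ≤ s + H ∧ s' + (compApply k n v).length ≤ s + N ∧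
      s + N ≤ s' + (compApply k n v).length + H ∧ Reads ρ (compApply k n v) s' := by
  obtain ⟨M, hM⟩ := hlen (s + N)
  have h1 := hM (n + M) (by omega) 2
  have h2 := reads_of_isPrefixSeq (hρ (n + M))
  rw [wlen, compApply_add] at h1
  rw [compApply_add] at h2
  set v0 := compApply (fun i => k (n + i)) M [2]
  obtain ⟨u, w, hv, hu1, hu2⟩ := exists_split hH v0 s (by omega)
  rw [hv, compApply_append, List.length_append] at h1
  obtain ⟨v, w', hw, hv1, hv2⟩ :=
    exists_split hH w (s + N - H - (compApply k n u).length) (by omega)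
  refine ⟨(compApply k n u).length, v, hu1, hu2, by omega, by omega, ?_⟩
  rw [hv, hw, compApply_append, compApply_append] at h2
  simpa using (reads_append.1 (reads_append.1 h2).2).1

end Parsing

/-- Birkhoff sum of the sequence `G` over the window `[s, s + N)`. -/
def winSum (G : ℕ → ℝ) (s N : ℕ) : ℝ := ∑ j ∈ Finset.range N, G (s + j)

/-- Every level-`n` block of `ρ` has `G`-average at most `t`. -/
def BlockBound (k : ℕ → ℕ) (ρ : ℕ → Fin 3) (G : ℕ → ℝ) (n : ℕ) (t : ℝ) : Prop :=
  ∀ a s, Reads ρ (compApply k n [a]) s → winSum G s (wlen k n a) ≤ t * wlen k n a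

section Averages

variable {k : ℕ → ℕ} {ρ : ℕ → Fin 3} {G : ℕ → ℝ} {C : ℝ}

lemma winSum_add (G : ℕ → ℝ) (s M N : ℕ) :
    winSum G s (M + N) = winSum G s M + winSum G (s + M) N := by
  simp only [winSum, Finset.sum_range_add, add_assoc]

lemma abs_winSum_le (hC : ∀ j, |G j| ≤ C) (s N : ℕ) : |winSum G s N| ≤ C * N := by
  refine (Finset.abs_sum_le_sum_abs _ _).trans ((Finset.sum_le_sum fun j _ => hC (s + j)).trans ?_)
  simp [mul_comm]

lemma winSum_neg (G : ℕ → ℝ) (s N : ℕ) : winSum (fun j => -G j) s N = -winSum G s N := by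
  simp [winSum]

lemma BlockBound.word {n : ℕ} {t : ℝ} (h : BlockBound k ρ G n t) (v : List (Fin 3)) (s : ℕ)
    (hv : Reads ρ (compApply k n v) s) :
    winSum G s (compApply k n v).length ≤ t * (compApply k n v).length := by
  induction v generalizing s with
  | nil => simp [compApply_nil, winSum]
  | cons a v ih =>
    rw [← List.singleton_append, compApply_append] at hv ⊢
    have h1 := h a s (reads_append.1 hv).1
    have h2 := ih _ (reads_append.1 hv).2
    rw [List.length_append, winSum_add, Nat.cast_add, mul_add]
    exact add_le_add h1 h2

lemma BlockBound.add {n : ℕ} {t : ℝ} (h : BlockBound k ρ G n t) (l : ℕ) :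
    BlockBound k ρ G (n + l) t := by
  intro a s hs
  rw [wlen, compApply_add] at *
  exact h.word _ _ hs

lemma BlockBound.mono {n : ℕ} {t t' : ℝ} (h : BlockBound k ρ G n t) (ht : t ≤ t') :
    BlockBound k ρ G n t' := fun a s hs =>
  (h a s hs).trans (mul_le_mul_of_nonneg_right ht (Nat.cast_nonneg _))

/-- Limit of the maximal block averages. -/
lemma exists_blockBound_limit (hρ : ∀ n, IsPrefixSeq (compApply k n [2]) ρ)
    (hC : ∀ j, |G j| ≤ C) :
    ∃ A : ℝ, ∀ ε > 0, (∃ n0, ∀ n ≥ n0, BlockBound k ρ G n (A + ε)) ∧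
      ∀ n, ¬ BlockBound k ρ G n (A - ε) := by
  set T : Set ℝ := {t | ∃ n, BlockBound k ρ G n t}
  have hne : T.Nonempty := ⟨C, 0, fun a s _ => (le_abs_self _).trans (abs_winSum_le hC _ _)⟩
  have hbdd : BddBelow T := by
    refine ⟨-C, ?_⟩
    rintro t ⟨n, hn⟩
    have h1 := hn 2 0 (reads_of_isPrefixSeq (hρ n))
    have h2 := (abs_le.1 (abs_winSum_le hC 0 (wlen k n 2))).1
    have h3 : (0 : ℝ) < wlen k n 2 := Nat.cast_pos.2 (wlen_pos k n 2)
    nlinarith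
  refine ⟨sInf T, fun ε hε => ⟨?_, fun n hn => ?_⟩⟩
  · obtain ⟨t, ⟨n, hn⟩, ht⟩ := exists_lt_of_csInf_lt hne (lt_add_of_pos_right (sInf T) hε)
    refine ⟨n, fun m hm => ?_⟩
    obtain ⟨l, rfl⟩ := Nat.exists_eq_add_of_le hm
    exact (hn.add l).mono ht.le
  · have := csInf_le hbdd (show sInf T - ε ∈ T from ⟨n, hn⟩)
    linarith

/-- A window average is controlled by the block averages up to boundary terms. -/
lemma BlockBound.winSum_le (hρ : ∀ n, IsPrefixSeq (compApply k n [2]) ρ)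
    (hlen : ∀ j, ∃ N, ∀ n ≥ N, ∀ a, j ≤ wlen k n a) (hC : ∀ j, |G j| ≤ C) {n : ℕ} {t : ℝ}
    (h : BlockBound k ρ G n t) :
    ∃ D : ℝ, ∀ s N, winSum G s N ≤ t * N + D := by
  obtain ⟨H, hH⟩ : ∃ H, ∀ b, wlen k n b ≤ H :=
    ⟨∑ b, wlen k n b, fun b => Finset.single_le_sum (fun _ _ => Nat.zero_le _) (Finset.mem_univ b)⟩
  have hC0 : 0 ≤ C := (abs_nonneg _).trans (hC 0)
  refine ⟨2 * H * (C + |t|), fun s N => ?_⟩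
  by_cases hN : 2 * H ≤ N
  · obtain ⟨s', v, h1, h2, h3, h4, h5⟩ := exists_parse hρ hlen hH s N hN
    have hv := h.word v s' h5
    set L := (compApply k n v).length
    obtain ⟨x, rfl⟩ := Nat.exists_eq_add_of_le h1
    obtain ⟨y, hy⟩ := Nat.exists_eq_add_of_le h3
    obtain rfl : N = x + L + y := by omega
    rw [winSum_add, winSum_add]
    have e1 := (le_abs_self _).trans (abs_winSum_le hC s x)
    have e2 := (le_abs_self _).trans (abs_winSum_le hC (s + (x + L)) y)
    have hx : (x : ℝ) ≤ H := by exact_mod_cast (by omega : x ≤ H)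
    have hy' : (y : ℝ) ≤ H := by exact_mod_cast (by omega : y ≤ H)
    push_cast
    have ht := neg_abs_le t
    nlinarith [abs_nonneg t, mul_le_mul_of_nonneg_left hx hC0, mul_le_mul_of_nonneg_left hy' hC0,
      mul_le_mul_of_nonneg_left hx (abs_nonneg t), mul_le_mul_of_nonneg_left hy' (abs_nonneg t),
      mul_le_mul_of_nonneg_right ht (Nat.cast_nonneg (α := ℝ) x),
      mul_le_mul_of_nonneg_right ht (Nat.cast_nonneg (α := ℝ) y)]
  · have e1 := (le_abs_self _).trans (abs_winSum_le hC s N)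
    have hN' : (N : ℝ) ≤ 2 * H := by exact_mod_cast (by omega : N ≤ 2 * H)
    have ht := neg_abs_le t
    nlinarith [abs_nonneg t, mul_le_mul_of_nonneg_left hN' hC0,
      mul_le_mul_of_nonneg_left hN' (abs_nonneg t),
      mul_le_mul_of_nonneg_right ht (Nat.cast_nonneg (α := ℝ) N)]

/-- `G` depends, up to `ε`, only on a window of `ρ`. -/
def WindowContinuous (ρ : ℕ → Fin 3) (G : ℕ → ℝ) : Prop :=
  ∀ ε > 0, ∃ L : ℕ, ∀ s s', (∀ i < L, ρ (s + i) = ρ (s' + i)) → |G s - G s'| ≤ ε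

lemma winSum_sub_le_of_reads (hC : ∀ j, |G j| ≤ C) {ε : ℝ} {L : ℕ}
    (hL : ∀ s s', (∀ i < L, ρ (s + i) = ρ (s' + i)) → |G s - G s'| ≤ ε)
    {w : List (Fin 3)} {s s' : ℕ} (h : Reads ρ w s) (h' : Reads ρ w s') :
    winSum G s w.length - winSum G s' w.length ≤ ε * w.length + 2 * C * L := by
  have hC0 : 0 ≤ C := (abs_nonneg _).trans (hC 0)
  have hε : 0 ≤ ε := (abs_nonneg _).trans (hL 0 0 fun _ _ => rfl)
  have key : ∀ j ∈ Finset.range w.length, G (s + j) - G (s' + j) ≤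
      ε + if w.length < L + j then 2 * C else 0 := by
    intro j hj
    split_ifs with hlt
    · have h1 := abs_le.1 (hC (s + j))
      have h2 := abs_le.1 (hC (s' + j))
      linarith
    · have : |G (s + j) - G (s' + j)| ≤ ε := by
        refine hL _ _ fun i hi => ?_
        rw [add_assoc, add_assoc, h (j + i) (by omega), h' (j + i) (by omega)]
      linarith [le_abs_self (G (s + j) - G (s' + j))]
  have hcard : (∑ j ∈ Finset.range w.length, if w.length < L + j then 2 * C else 0) ≤
      2 * C * L := by
    rw [← Finset.sum_filter, Finset.sum_const, nsmul_eq_mul, mul_comm]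
    refine mul_le_mul_of_nonneg_left ?_ (by positivity)
    have : ((Finset.range w.length).filter fun j => w.length < L + j) ⊆
        Finset.Ico (w.length - L) w.length := by
      intro j hj
      simp only [Finset.mem_filter, Finset.mem_range, Finset.mem_Ico] at hj ⊢
      omega
    have := Finset.card_le_card this
    rw [Nat.card_Ico] at this
    exact_mod_cast this.trans (by omega)
  rw [winSum, winSum, ← Finset.sum_sub_distrib]
  refine (Finset.sum_le_sum key).trans ?_
  rw [Finset.sum_add_distrib]
  refine add_le_add ?_ hcard
  simp [mul_comm]

/-- Uniform convergence of window averages for a linearly recurrent substitutive sequence. -/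
lemma exists_uniform_average (hρ : ∀ n, IsPrefixSeq (compApply k n [2]) ρ)
    (hlen : ∀ j, ∃ N, ∀ n ≥ N, ∀ a, j ≤ wlen k n a) {n1 q K : ℕ}
    (hq : ∀ n ≥ n1, ∀ a b, Reach k n q b a)
    (hK : ∀ n ≥ n1, ∀ a b, wlen k (n + q) b ≤ K * wlen k n a)
    (hC : ∀ j, |G j| ≤ C) (hG : WindowContinuous ρ G) :
    ∃ A : ℝ, ∀ ε > 0, ∃ D : ℝ, ∀ s N, |winSum G s N - A * N| ≤ ε * N + D := by
  have hC' : ∀ j, |(fun j => -G j) j| ≤ C := fun j => by simpa using hC j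
  obtain ⟨A, hA⟩ := exists_blockBound_limit hρ hC
  obtain ⟨A', hA'⟩ := exists_blockBound_limit hρ hC'
  have key : ∀ ε > 0, A + A' ≤ ε * (2 * K + 2) := by
    intro ε hε
    obtain ⟨L, hL⟩ := hG ε hε
    obtain ⟨n2, hn2⟩ := (hA' ε hε).1
    obtain ⟨j, hj⟩ := exists_nat_ge (2 * C * L / ε)
    obtain ⟨n3, hn3⟩ := hlen j
    obtain ⟨n, h1, h2, h3⟩ : ∃ n, n1 ≤ n ∧ n2 ≤ n ∧ n3 ≤ n := ⟨n1 + n2 + n3, by omega⟩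
    have hB := (hA ε hε).2 n
    have hB' := (hA' ε hε).2 (n + q)
    unfold BlockBound at hB hB'
    push Not at hB hB'
    obtain ⟨a, i, hi, hlt⟩ := hB
    obtain ⟨b, s, hs, hlt'⟩ := hB'
    have hab := hK n h1 a b
    have hja := hn3 n h3 a
    obtain ⟨u, w, huw⟩ := List.append_of_mem (hq n h1 a b)
    rw [wlen, compApply_add, huw, ← List.singleton_append, compApply_append, compApply_append]
      at hlt' hab
    rw [compApply_add, huw, ← List.singleton_append, compApply_append, compApply_append] at hs
    obtain ⟨hu, haw⟩ := reads_append.1 hs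
    obtain ⟨ha, hw⟩ := reads_append.1 haw
    rw [List.length_append, List.length_append, winSum_add, winSum_add] at hlt'
    rw [List.length_append, List.length_append] at hab
    have e1 := (hn2 n h2).word u s hu
    have e2 := (hn2 n h2).word w _ hw
    have e3 := winSum_sub_le_of_reads hC hL hi ha
    rw [winSum_neg] at e1 e2
    simp only [winSum_neg] at hlt'
    have hwa : (compApply k n [a]).length = wlen k n a := rfl
    rw [hwa] at e2 e3 hlt' hab
    set hu' := (compApply k n u).length
    set hw' := (compApply k n w).length
    set h := wlen k n a with hh
    have hpos : (0 : ℝ) < h := Nat.cast_pos.2 (wlen_pos k n a)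
    have hab' : (hu' : ℝ) + (h + hw') ≤ K * h := by exact_mod_cast hab
    have hja' : 2 * C * L ≤ ε * h := by
      have : 2 * C * L / ε ≤ h := hj.trans (by exact_mod_cast hja)
      rwa [div_le_iff₀ hε, mul_comm (h : ℝ)] at this
    push_cast at hlt'
    have : (A + A') * h < ε * (2 * K + 2) * h := by
      nlinarith [mul_le_mul_of_nonneg_left hab' hε.le]
    exact le_of_lt (lt_of_mul_lt_mul_right this hpos.le)
  have hAA : A + A' ≤ 0 := by
    by_contra! hcon
    have h1 : (0 : ℝ) < 2 * K + 2 := by positivity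
    have := key ((A + A') / (2 * (2 * K + 2))) (by positivity)
    rw [div_mul_eq_mul_div, le_div_iff₀ (by positivity)] at this
    nlinarith
  refine ⟨A, fun ε hε => ?_⟩
  obtain ⟨n2, hn2⟩ := (hA ε hε).1
  obtain ⟨n3, hn3⟩ := (hA' ε hε).1
  obtain ⟨D1, hD1⟩ := (hn2 n2 le_rfl).winSum_le hρ hlen hC
  obtain ⟨D2, hD2⟩ := (hn3 n3 le_rfl).winSum_le hρ hlen hC'
  refine ⟨max D1 D2, fun s N => abs_le.2 ⟨?_, ?_⟩⟩
  · have := hD2 s N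
    rw [winSum_neg] at this
    nlinarith [le_max_right D1 D2, Nat.cast_nonneg (α := ℝ) N]
  · nlinarith [hD1 s N, le_max_left D1 D2]

end Averages

section Dynamics

variable {k : ℕ → ℕ} {ρ : ℕ → Fin 3}

lemma shift_iterate (j : ℕ) (x : ℕ → Fin 3) : shift^[j] x = fun i => x (i + j) := by
  induction j generalizing x with
  | zero => rfl
  | succ j ih =>
    rw [Function.iterate_succ_apply, ih]
    funext i
    simp only [shift, add_assoc]

lemma continuous_shift : Continuous shift :=
  continuous_pi fun i => continuous_apply (i + 1)

lemma orbit_mem_orbitClosure (ρ : ℕ → Fin 3) (s : ℕ) : shift^[s] ρ ∈ orbitClosure ρ :=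
  subset_closure ⟨s, shift_iterate s ρ⟩

lemma orbitClosure_subset {F : Set (ℕ → Fin 3)} (hF : IsClosed F) (h : ∀ s, shift^[s] ρ ∈ F) :
    orbitClosure ρ ⊆ F := by
  refine closure_minimal ?_ hF
  rintro y ⟨s, rfl⟩
  exact shift_iterate s ρ ▸ h s

lemma exists_window_of_continuous {F : Type*} [PseudoMetricSpace F] {g : (ℕ → Fin 3) → F}
    (hg : Continuous g) {ε : ℝ} (hε : 0 < ε) :
    ∃ L : ℕ, ∀ x y, (∀ i < L, x i = y i) → dist (g x) (g y) < ε := by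
  let _ : MetricSpace (ℕ → Fin 3) := PiNat.metricSpace
  have hu := CompactSpace.uniformContinuous_of_continuous hg
  obtain ⟨δ, hδ, h⟩ := Metric.uniformContinuous_iff.1 hu ε hε
  obtain ⟨L, hL⟩ := exists_pow_lt_of_lt_one hδ (by norm_num : (1 / 2 : ℝ) < 1)
  refine ⟨L, fun x y hxy => h (lt_of_le_of_lt ?_ hL)⟩
  exact PiNat.mem_cylinder_iff_dist_le.1 (PiNat.mem_cylinder_iff.2 hxy)

lemma windowContinuous_of_continuous {g : (ℕ → Fin 3) → ℝ} (hg : Continuous g) :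
    WindowContinuous ρ fun j => g (shift^[j] ρ) := by
  intro ε hε
  obtain ⟨L, hL⟩ := exists_window_of_continuous hg hε
  refine ⟨L, fun s s' h => (hL _ _ fun i hi => ?_).le⟩
  simpa only [shift_iterate, add_comm] using h i hi

lemma exists_uniform_orbit_average {g : (ℕ → Fin 3) → ℝ} (hg : Continuous g)
    (havg : ∃ A : ℝ, ∀ ε > 0, ∃ D : ℝ, ∀ s N,
      |winSum (fun j => g (shift^[j] ρ)) s N - A * N| ≤ ε * N + D) :
    ∃ A : ℝ, ∀ ε > 0, ∃ D : ℝ, ∀ x ∈ orbitClosure ρ, ∀ N : ℕ,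
      |∑ j ∈ Finset.range N, g (shift^[j] x) - A * N| ≤ ε * N + D := by
  obtain ⟨A, hA⟩ := havg
  refine ⟨A, fun ε hε => ?_⟩
  obtain ⟨D, hD⟩ := hA ε hε
  refine ⟨D, fun x hx N => ?_⟩
  have hcl : IsClosed {x | |∑ j ∈ Finset.range N, g (shift^[j] x) - A * N| ≤ ε * N + D} := by
    refine isClosed_le ?_ continuous_const
    refine ((continuous_finsetSum _ fun j _ => ?_).sub continuous_const).abs
    exact hg.comp (continuous_shift.iterate j)
  refine orbitClosure_subset hcl (fun s => ?_) hx
  have := hD s N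
  simpa only [winSum, Set.mem_ofPred_eq, ← Function.iterate_add_apply, add_comm] using this

variable {X : Set (ℕ → Fin 3)} {μ : Measure (ℕ → Fin 3)}

lemma IsInvProb.measurePreserving (h : IsInvProb X μ) : MeasurePreserving shift μ μ :=
  ⟨continuous_shift.measurable, h.2.2⟩

lemma IsInvProb.ae_mem (h : IsInvProb X μ) : ∀ᵐ x ∂μ, x ∈ X := h.2.1

lemma IsInvProb.integral_sum_iterate (h : IsInvProb X μ) {g : (ℕ → Fin 3) → ℝ}
    (hg : Continuous g) (N : ℕ) :
    ∫ x, ∑ j ∈ Finset.range N, g (shift^[j] x) ∂μ = N * ∫ x, g x ∂μ := by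
  have := h.1
  have hint : ∀ g : (ℕ → Fin 3) → ℝ, Continuous g → Integrable g μ := fun g hg =>
    (BoundedContinuousFunction.mkOfCompact ⟨g, hg⟩).integrable μ
  have hsum : ∀ j, Integrable (fun x => g (shift^[j] x)) μ := fun j =>
    hint _ (hg.comp (continuous_shift.iterate j))
  rw [integral_finsetSum _ fun j _ => hsum j]
  have : ∀ j, ∫ x, g (shift^[j] x) ∂μ = ∫ x, g x ∂μ := fun j => by
    have hj := h.measurePreserving.iterate j
    conv_rhs => rw [← hj.map_eq]
    rw [integral_map hj.measurable.aemeasurable hg.aestronglyMeasurable]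
  simp [this]

lemma IsInvProb.integral_eq (h : IsInvProb X μ) {g : (ℕ → Fin 3) → ℝ} (hg : Continuous g) {A : ℝ}
    (hA : ∀ ε > 0, ∃ D : ℝ, ∀ x ∈ X, ∀ N : ℕ,
      |∑ j ∈ Finset.range N, g (shift^[j] x) - A * N| ≤ ε * N + D) :
    ∫ x, g x ∂μ = A := by
  have := h.1
  have key : ∀ ε > 0, |∫ x, g x ∂μ - A| ≤ ε := by
    intro ε hε
    obtain ⟨D, hD⟩ := hA ε hε
    have hN : ∀ N : ℕ, |∫ x, g x ∂μ - A| * N ≤ ε * N + D := by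
      intro N
      have hc : Continuous fun x => ∑ j ∈ Finset.range N, g (shift^[j] x) :=
        continuous_finsetSum _ fun j _ => hg.comp (continuous_shift.iterate j)
      have hint : Integrable (fun x => ∑ j ∈ Finset.range N, g (shift^[j] x)) μ :=
        (BoundedContinuousFunction.mkOfCompact ⟨_, hc⟩).integrable μ
      have h1 : ∫ x, (∑ j ∈ Finset.range N, g (shift^[j] x) - A * N) ∂μ =
          (∫ x, g x ∂μ - A) * N := by
        rw [integral_sub hint (integrable_const _), h.integral_sum_iterate hg]
        simp; ring
      have h2 := norm_integral_le_of_norm_le_const (μ := μ)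
        (f := fun x => ∑ j ∈ Finset.range N, g (shift^[j] x) - A * N) (C := ε * N + D)
        (h.ae_mem.mono fun x hx => hD x hx N)
      rw [h1, Real.norm_eq_abs, abs_mul, Nat.abs_cast] at h2
      simpa using h2
    by_contra! hcon
    obtain ⟨N, hN'⟩ := exists_nat_gt (D / (|∫ x, g x ∂μ - A| - ε))
    rw [div_lt_iff₀ (by linarith)] at hN'
    nlinarith [hN N]
  have h0 : |∫ x, g x ∂μ - A| ≤ 0 := le_of_forall_pos_le_add fun ε hε => by simpa using key ε hε
  have := abs_nonpos_iff.1 h0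
  linarith

/-- Two invariant measures of a subshift with uniform Birkhoff averages agree. -/
lemma IsInvProb.unique
    (havg : ∀ g : (ℕ → Fin 3) → ℝ, Continuous g → ∃ A : ℝ, ∀ ε > 0, ∃ D : ℝ, ∀ x ∈ X, ∀ N : ℕ,
      |∑ j ∈ Finset.range N, g (shift^[j] x) - A * N| ≤ ε * N + D)
    {ν : Measure (ℕ → Fin 3)} (hμ : IsInvProb X μ) (hν : IsInvProb X ν) : μ = ν := by
  have := hμ.1
  have := hν.1
  refine ext_of_forall_integral_eq_of_IsFiniteMeasure fun g => ?_
  obtain ⟨A, hA⟩ := havg g g.continuous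
  rw [hμ.integral_eq g.continuous hA, hν.integral_eq g.continuous hA]

/-- The empirical measure of the first `N + 1` points of the orbit of `ρ`. -/
noncomputable def empirical (ρ : ℕ → Fin 3) (N : ℕ) : Measure (ℕ → Fin 3) :=
  ((N : ENNReal) + 1)⁻¹ • ∑ j ∈ Finset.range (N + 1), Measure.dirac (shift^[j] ρ)

lemma isProbabilityMeasure_empirical (ρ : ℕ → Fin 3) (N : ℕ) :
    IsProbabilityMeasure (empirical ρ N) := by
  refine ⟨?_⟩
  simp only [empirical, Measure.smul_apply, Measure.finsetSum_apply, measure_univ, smul_eq_mul,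
    Finset.sum_const, Finset.card_range, nsmul_eq_mul, mul_one, Nat.cast_add, Nat.cast_one]
  exact ENNReal.inv_mul_cancel (by simp) (by finiteness)

lemma integral_empirical (ρ : ℕ → Fin 3) (N : ℕ) {g : (ℕ → Fin 3) → ℝ} (hg : Continuous g) :
    ∫ x, g x ∂(empirical ρ N) = (N + 1 : ℝ)⁻¹ * ∑ j ∈ Finset.range (N + 1), g (shift^[j] ρ) := by
  rw [empirical, integral_smul_measure, integral_finsetSum_measure]
  · have : (((N : ENNReal) + 1)⁻¹).toReal = (N + 1 : ℝ)⁻¹ := by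
      rw [ENNReal.toReal_inv, ENNReal.toReal_add (by finiteness) (by finiteness)]; simp
    rw [this, smul_eq_mul]
    simp
  · exact fun j _ => (BoundedContinuousFunction.mkOfCompact ⟨g, hg⟩).integrable _

/-- Krylov–Bogoliubov for the orbit closure of `ρ`. -/
lemma exists_isInvProb (ρ : ℕ → Fin 3) : ∃ μ, IsInvProb (orbitClosure ρ) μ := by
  set P : ℕ → ProbabilityMeasure (ℕ → Fin 3) := fun N =>
    ⟨empirical ρ N, isProbabilityMeasure_empirical ρ N⟩
  have : Nonempty (ProbabilityMeasure (ℕ → Fin 3)) := ⟨P 0⟩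
  set F : Ultrafilter ℕ := hyperfilter ℕ
  obtain ⟨μ, hμ⟩ : ∃ μ, Tendsto P F (𝓝 μ) := ⟨_, (F.map P).le_nhds_lim⟩
  have hF : (F : Filter ℕ) ≤ atTop := by rw [← Nat.cofinite_eq_atTop]; exact hyperfilter_le_cofinite
  have hint := ProbabilityMeasure.tendsto_iff_forall_integral_tendsto.1 hμ
  refine ⟨μ, inferInstance, ?_, ?_⟩
  · have h1 := ProbabilityMeasure.le_liminf_measure_open_of_tendsto hμ
      (isClosed_closure (s := {y | ∃ n : ℕ, y = fun i => ρ (i + n)})).isOpen_compl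
    have h2 : ∀ N, (P N : Measure (ℕ → Fin 3)) (orbitClosure ρ)ᶜ = 0 := by
      intro N
      simp only [P, ProbabilityMeasure.coe_mk, empirical, Measure.smul_apply,
        Measure.finsetSum_apply, smul_eq_mul, mul_eq_zero, Finset.sum_eq_zero_iff]
      right
      intro j _
      have hm : MeasurableSet (orbitClosure ρ)ᶜ := isClosed_closure.isOpen_compl.measurableSet
      rw [Measure.dirac_apply' _ hm]
      simp [orbit_mem_orbitClosure ρ j]
    change _ ≤ liminf (fun i => (P i : Measure (ℕ → Fin 3)) (orbitClosure ρ)ᶜ) _ at h1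
    simp only [h2, liminf_const] at h1
    exact le_antisymm h1 bot_le
  · have : IsProbabilityMeasure ((μ : Measure (ℕ → Fin 3)).map shift) :=
      Measure.isProbabilityMeasure_map continuous_shift.measurable.aemeasurable
    refine ext_of_forall_integral_eq_of_IsFiniteMeasure fun g => ?_
    rw [integral_map continuous_shift.measurable.aemeasurable
      g.continuous.aestronglyMeasurable]
    have t1 := hint g
    have t2 := hint (g.compContinuous ⟨shift, continuous_shift⟩)
    have t3 : Tendsto (fun N : ℕ => 2 * ‖g‖ * (N + 1 : ℝ)⁻¹) F (𝓝 0) := by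
      have : Tendsto (fun N : ℕ => (N + 1 : ℝ)⁻¹) atTop (𝓝 0) := by
        simpa using tendsto_one_div_add_atTop_nhds_zero_nat (𝕜 := ℝ)
      simpa using (this.const_mul (2 * ‖g‖)).mono_left hF
    refine tendsto_nhds_unique t2 ?_
    have t4 := t1.add (squeeze_zero_norm (a := fun N : ℕ => 2 * ‖g‖ * (N + 1 : ℝ)⁻¹)
      (f := fun N => ∫ x, g (shift x) ∂(P N : Measure (ℕ → Fin 3)) -
        ∫ x, g x ∂(P N : Measure (ℕ → Fin 3))) (fun N => ?_) t3)
    · simpa using t4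
    · change ‖∫ x, g (shift x) ∂(empirical ρ N) - ∫ x, g x ∂(empirical ρ N)‖ ≤ _
      rw [integral_empirical ρ N g.continuous,
        integral_empirical ρ N (g := fun x => g (shift x)) (g.continuous.comp continuous_shift),
        ← mul_sub, ← Finset.sum_sub_distrib]
      simp only [← Function.iterate_succ_apply' shift]
      rw [Finset.sum_range_sub (fun j => g (shift^[j] ρ)), norm_mul, mul_comm]
      have hp : (0 : ℝ) < (N + 1 : ℝ)⁻¹ := by positivity
      rw [Real.norm_of_nonneg hp.le]
      refine mul_le_mul_of_nonneg_right ?_ hp.le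
      refine (norm_sub_le _ _).trans ?_
      linarith [g.norm_coe_le_norm (shift^[N + 1] ρ), g.norm_coe_le_norm (shift^[0] ρ)]

/-- Unique ergodicity implies ergodicity. -/
lemma IsInvProb.ergodic (hμ : IsInvProb X μ)
    (huniq : ∀ ν, IsInvProb X ν → ν = μ) : Ergodic shift μ := by
  have := hμ.1
  refine ⟨hμ.measurePreserving, ⟨fun s hs hinv => ?_⟩⟩
  by_cases h0 : μ s = 0
  · exact eventuallyConst_set'.2 (Or.inl (ae_eq_empty.2 h0))
  have hcond : IsInvProb X (ProbabilityTheory.cond μ s) := by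
    refine ⟨ProbabilityTheory.cond_isProbabilityMeasure h0, ?_, ?_⟩
    · exact ProbabilityTheory.cond_absolutelyContinuous hμ.2.1
    · have hr : (μ.restrict s).map shift = μ.restrict s := by
        have := (hμ.measurePreserving.restrict_preimage hs).map_eq
        rwa [hinv] at this
      rw [ProbabilityTheory.cond, Measure.map_smul, hr]
  have h1 := huniq _ hcond
  refine eventuallyConst_set'.2 (Or.inr (ae_eq_univ.2 ?_))
  rw [← h1, ProbabilityTheory.cond_apply hs]
  simp

end Dynamics

section Return

variable {k : ℕ → ℕ} {ρ : ℕ → Fin 3}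

lemma exists_compApply_two_eq_cons (k : ℕ → ℕ) (a : Fin 3) :
    ∃ w, compApply k 2 [a] = 2 :: w := by
  fin_cases a <;> simp [compApply, applyChi, chiSub]

lemma Reads.head_word {n : ℕ} {a : Fin 3} {s : ℕ} (h : Reads ρ (compApply k (n + 2) [a]) s) :
    Reads ρ (compApply k n [2]) s := by
  obtain ⟨w, hw⟩ := exists_compApply_two_eq_cons (fun i => k (n + i)) a
  rw [compApply_add, hw, ← List.singleton_append, compApply_append] at h
  exact (reads_append.1 h).1

/-- Two consecutive blocks of level `n + 2` produce a long near-return. -/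
lemma Reads.near_return {n : ℕ} {a b : Fin 3} {v : List (Fin 3)} {s : ℕ}
    (h : Reads ρ (compApply k (n + 2) (a :: b :: v)) s) {i : ℕ} (hi : i < wlen k n 2) :
    ρ (s + i) = ρ (s + i + wlen k (n + 2) a) := by
  rw [← List.singleton_append, compApply_append] at h
  obtain ⟨h1, h2⟩ := reads_append.1 h
  rw [← List.singleton_append (x := b), compApply_append] at h2
  have h3 := h1.head_word i hi
  have h4 := (reads_append.1 h2).1.head_word i hi
  rw [h3, ← h4, wlen]
  congr 1; omega

lemma exists_near_return (hρ : ∀ n, IsPrefixSeq (compApply k n [2]) ρ)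
    (hlen : ∀ j, ∃ N, ∀ n ≥ N, ∀ a, j ≤ wlen k n a) {n q H : ℕ}
    (hq : ∀ a b, Reach k (n + 2) q b a) (hH : ∀ b, wlen k (n + (q + 2)) b ≤ H)
    (a : Fin 3) (s : ℕ) :
    ∃ t, s ≤ t ∧ t + wlen k n 2 ≤ s + 4 * H ∧
      ∀ i < wlen k n 2, ρ (t + i) = ρ (t + i + wlen k (n + 2) a) := by
  have e : n + (q + 2) = n + 2 + q := by omega
  rw [e] at hH
  have hH0 := (wlen_pos k (n + 2 + q) 0).trans_le (hH 0)
  obtain ⟨s', v, h1, h2, h3, h4, h5⟩ := exists_parse hρ hlen hH s (4 * H) (by omega)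
  obtain ⟨b1, b2, v, rfl⟩ : ∃ b1 b2 w, v = b1 :: b2 :: w := by
    match v with
    | [] => simp [compApply_nil] at h4; omega
    | [b] => have := hH b; rw [wlen] at this; omega
    | b1 :: b2 :: w => exact ⟨b1, b2, w, rfl⟩
  rw [compApply_add, ← List.singleton_append, compApply_append] at h5 h3
  obtain ⟨u, u', hu⟩ := List.append_of_mem (hq a b1)
  obtain ⟨b, z, hz⟩ : ∃ b z, u' ++ compApply (fun i => k (n + 2 + i)) q (b2 :: v) = b :: z := by
    have : u' ++ compApply (fun i => k (n + 2 + i)) q (b2 :: v) ≠ [] := by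
      rw [← List.singleton_append, compApply_append]
      have := List.ne_nil_of_mem (hq a b2)
      simp [this]
    exact List.exists_cons_of_ne_nil this
  rw [hu, List.append_assoc, List.cons_append, hz, compApply_append] at h5 h3
  obtain ⟨-, h6⟩ := reads_append.1 h5
  refine ⟨_, by omega, ?_, fun i hi => h6.near_return hi⟩
  rw [List.length_append, length_compApply_cons, length_compApply_cons] at h3
  have h7 : wlen k n 2 ≤ wlen k (n + 2) a := (reach_two k n 0 a).wlen_le
  omega

/-- Points whose first `L` letters agree with those after time `h`. -/
def agreeSet (L h : ℕ) : Set (ℕ → Fin 3) := {x | ∀ i < L, x i = x (i + h)}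

lemma isClopen_agreeSet (L h : ℕ) : IsClopen (agreeSet L h) := by
  have : agreeSet L h = ⋂ i ∈ Finset.range L, {x : ℕ → Fin 3 | x i = x (i + h)} := by
    ext x; simp [agreeSet]
  rw [this]
  refine isClopen_biInter_finset fun i _ => ?_
  have hc : Continuous fun x : ℕ → Fin 3 => (x i, x (i + h)) := by fun_prop
  exact (isClopen_discrete {p : Fin 3 × Fin 3 | p.1 = p.2}).preimage hc

lemma le_sum_indicator_agreeSet {s t M N L h : ℕ} (h1 : s ≤ t) (h2 : t + M ≤ s + N)
    (h3 : ∀ i < M, ρ (t + i) = ρ (t + i + h)) (hL : 2 * L ≤ M) :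
    (M / 2 : ℝ) ≤ ∑ j ∈ Finset.range N,
      (agreeSet L h).indicator (fun _ => (1 : ℝ)) (shift^[j] (shift^[s] ρ)) := by
  set T : Finset ℕ := Finset.Ico (t - s) (t - s + (M - L))
  have hT : T ⊆ Finset.range N := fun j hj => by
    rw [Finset.mem_Ico] at hj; rw [Finset.mem_range]; omega
  refine le_trans ?_ (Finset.sum_le_sum_of_subset_of_nonneg hT fun j _ _ =>
    Set.indicator_nonneg (fun _ _ => zero_le_one) _)
  rw [Finset.sum_congr rfl (g := fun _ => (1 : ℝ))]
  · simp only [T, Finset.sum_const, Nat.card_Ico, nsmul_eq_mul, mul_one]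
    rw [add_tsub_cancel_left, Nat.cast_sub (by omega)]
    have : (2 * L : ℝ) ≤ M := by exact_mod_cast hL
    linarith
  · intro j hj
    rw [Finset.mem_Ico] at hj
    refine Set.indicator_of_mem ?_ _
    intro i hi
    simp only [shift_iterate]
    have := h3 (i + j + s - t) (by omega)
    convert this using 2 <;> omega

lemma IsInvProb.le_measure_agreeSet {μ : Measure (ℕ → Fin 3)} (hμ : IsInvProb (orbitClosure ρ) μ)
    (hρ : ∀ n, IsPrefixSeq (compApply k n [2]) ρ)
    (hlen : ∀ j, ∃ N, ∀ n ≥ N, ∀ a, j ≤ wlen k n a) {n q K L : ℕ}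
    (hq : ∀ a b, Reach k (n + 2) q b a) (hK : ∀ b, wlen k (n + (q + 2)) b ≤ K * wlen k n 2)
    (hL : 2 * L ≤ wlen k n 2) (a : Fin 3) :
    (1 : ℝ) / (8 * K) ≤ μ.real (agreeSet L (wlen k (n + 2) a)) := by
  have := hμ.1
  set U := agreeSet L (wlen k (n + 2) a)
  set N := 4 * (K * wlen k n 2)
  set g : (ℕ → Fin 3) → ℝ := U.indicator fun _ => 1
  have hU : IsClopen U := isClopen_agreeSet _ _
  have hg : Continuous g := hU.continuous_indicator continuous_const
  have hc : Continuous fun x => ∑ j ∈ Finset.range N, g (shift^[j] x) :=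
    continuous_finsetSum _ fun j _ => hg.comp (continuous_shift.iterate j)
  have hX : orbitClosure ρ ⊆
      {x | (wlen k n 2 / 2 : ℝ) ≤ ∑ j ∈ Finset.range N, g (shift^[j] x)} := by
    refine orbitClosure_subset (isClosed_le continuous_const hc) fun s => ?_
    obtain ⟨t, h1, h2, h3⟩ := exists_near_return hρ hlen hq hK a s
    exact le_sum_indicator_agreeSet h1 h2 h3 hL
  have hint : Integrable (fun x => ∑ j ∈ Finset.range N, g (shift^[j] x)) μ :=
    (BoundedContinuousFunction.mkOfCompact ⟨_, hc⟩).integrable μ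
  have h1 := integral_mono_ae (integrable_const (wlen k n 2 / 2 : ℝ)) hint
    (hμ.ae_mem.mono fun x hx => hX hx)
  rw [hμ.integral_sum_iterate hg, integral_indicator_const _ hU.1.measurableSet] at h1
  have hw : (0 : ℝ) < wlen k n 2 := Nat.cast_pos.2 (wlen_pos k n 2)
  have hK0 : (0 : ℝ) < K := by
    rcases Nat.eq_zero_or_pos K with rfl | h
    · have := hK 0
      have := wlen_pos k (n + (q + 2)) 0
      omega
    · exact_mod_cast h
  simp only [integral_const, probReal_univ, smul_eq_mul, one_mul, mul_one, N] at h1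
  push_cast at h1
  rw [div_le_iff₀ (by positivity)]
  refine le_of_mul_le_mul_right ?_ hw
  linarith

end Return

section Eigenfunction

variable {X : Set (ℕ → Fin 3)} {μ : Measure (ℕ → Fin 3)} {f : (ℕ → Fin 3) → ℂ} {c : ℂ}

lemma iterate_eigen (hμ : IsInvProb X μ) (hc : (fun x => f (shift x)) =ᵐ[μ] fun x => c * f x)
    (h : ℕ) : (fun x => f (shift^[h] x)) =ᵐ[μ] fun x => c ^ h * f x := by
  induction h with
  | zero => simp
  | succ h ih =>
    have h1 := (hμ.measurePreserving.iterate h).quasiMeasurePreserving.ae_eq_comp hc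
    filter_upwards [h1, ih] with x h1 h2
    simp only [Function.comp_apply] at h1
    rw [Function.iterate_succ_apply', h1, h2]; ring

lemma norm_eigenvalue_eq_one (hμ : IsInvProb X μ) (hf : AEMeasurable f μ) (hf0 : ¬ f =ᵐ[μ] 0)
    (hc : (fun x => f (shift x)) =ᵐ[μ] fun x => c * f x) : ‖c‖ = 1 := by
  have := hμ.1
  set φ : (ℕ → Fin 3) → ℝ := fun x => ‖f x‖ / (1 + ‖f x‖)
  have hle : ∀ x, ‖φ x‖ ≤ 1 := fun x => by
    have := norm_nonneg (f x)
    rw [Real.norm_of_nonneg (by positivity), div_le_one (by positivity)]; linarith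
  have hφm : AEStronglyMeasurable φ μ :=
    (hf.norm.div (hf.norm.const_add 1)).aestronglyMeasurable
  have hφ : Integrable φ μ := .of_bound hφm 1 (.of_forall hle)
  have hmp := hμ.measurePreserving
  have hφs : Integrable (fun x => φ (shift x)) μ := hmp.integrable_comp_of_integrable hφ
  have heq : ∫ x, φ (shift x) ∂μ = ∫ x, φ x ∂μ := by
    conv_rhs => rw [← hmp.map_eq]
    rw [integral_map hmp.measurable.aemeasurable (by rwa [hmp.map_eq])]
  have hmono : ∀ u v : ℝ, 0 ≤ u → u ≤ v → u / (1 + u) ≤ v / (1 + v) := fun u v hu huv => by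
    rw [div_le_div_iff₀ (by linarith) (by linarith)]; nlinarith
  have key : (fun x => φ (shift x)) =ᵐ[μ] φ := by
    rcases le_total ‖c‖ 1 with h | h
    · refine (integral_eq_iff_of_ae_le hφs hφ ?_).1 heq
      filter_upwards [hc] with x hx
      simp only [φ]
      rw [hx, norm_mul]
      exact hmono _ _ (by positivity) (mul_le_of_le_one_left (norm_nonneg _) h)
    · refine ((integral_eq_iff_of_ae_le hφ hφs ?_).1 heq.symm).symm
      filter_upwards [hc] with x hx
      simp only [φ]
      rw [hx, norm_mul]
      exact hmono _ _ (by positivity) (le_mul_of_one_le_left (norm_nonneg _) h)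
  by_contra hne
  refine hf0 ?_
  filter_upwards [key, hc] with x h1 h2
  simp only [φ, h2, norm_mul] at h1
  have := norm_nonneg (f x)
  have := norm_nonneg c
  rw [div_eq_div_iff (by positivity) (by positivity)] at h1
  have h3 : (‖c‖ - 1) * ‖f x‖ = 0 := by linarith
  rcases mul_eq_zero.1 h3 with h | h
  · exact absurd (by linarith) hne
  · exact norm_eq_zero.1 h

lemma exists_norm_eq_const (hμ : IsInvProb X μ) (herg : Ergodic shift μ) (hf : AEMeasurable f μ)
    (hf0 : ¬ f =ᵐ[μ] 0) (hc : (fun x => f (shift x)) =ᵐ[μ] fun x => c * f x) :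
    ∃ r > 0, ∀ᵐ x ∂μ, ‖f x‖ = r := by
  have := hμ.1
  have h1 := norm_eigenvalue_eq_one hμ hf hf0 hc
  obtain ⟨r, hr⟩ := herg.ae_eq_const_of_ae_eq_comp_ae (g := fun x => ‖f x‖)
    hf.norm.aestronglyMeasurable (by
      filter_upwards [hc] with x hx
      simp [hx, h1])
  refine ⟨r, ?_, hr⟩
  by_contra! hr0
  refine hf0 ?_
  filter_upwards [hr] with x hx
  simp only [Function.const_apply] at hx
  exact norm_le_zero_iff.1 (hx ▸ hr0)

/-- Frequent near-returns at times `h` force `c ^ h` to be close to one. -/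
lemma eigenvalue_pow_near_one (hμ : IsInvProb X μ) (herg : Ergodic shift μ)
    (hf : AEMeasurable f μ) (hf0 : ¬ f =ᵐ[μ] 0)
    (hc : (fun x => f (shift x)) =ᵐ[μ] fun x => c * f x) {δ : ℝ} (hδ : 0 < δ) {ε : ℝ}
    (hε : 0 < ε) : ∃ L, ∀ h, δ ≤ μ.real (agreeSet L h) → ‖c ^ h - 1‖ ≤ ε := by
  have := hμ.1
  obtain ⟨r, hr, hfr⟩ := exists_norm_eq_const hμ herg hf hf0 hc
  have hfi : Integrable f μ := .of_bound hf.aestronglyMeasurable r (hfr.mono fun x hx => hx.le)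
  set ε' := ε * δ * r / 3
  have hε' : 0 < ε' := by positivity
  obtain ⟨g, hg, hgi⟩ := hfi.exists_boundedContinuous_integral_sub_le hε'
  obtain ⟨L, hL⟩ := exists_window_of_continuous g.continuous hε'
  refine ⟨L, fun h hh => ?_⟩
  set U := agreeSet L h
  set ψ : (ℕ → Fin 3) → ℝ := fun x => ‖f x - g x‖
  have hψ : Integrable ψ μ := (hfi.sub hgi).norm
  have hmp := hμ.measurePreserving.iterate h
  have hψs : Integrable (fun x => ψ (shift^[h] x)) μ := hmp.integrable_comp_of_integrable hψ
  have heq : ∫ x, ψ (shift^[h] x) ∂μ = ∫ x, ψ x ∂μ := by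
    conv_rhs => rw [← hmp.map_eq]
    rw [integral_map hmp.measurable.aemeasurable (by rw [hmp.map_eq]; exact hψ.1)]
  have hU : MeasurableSet U := (isClopen_agreeSet L h).1.measurableSet
  have hi2 : Integrable (fun x => ψ (shift^[h] x) + ψ x + ε') μ :=
    (hψs.add hψ).add (integrable_const _)
  have hle : ∫ x, U.indicator (fun _ => ‖c ^ h - 1‖ * r) x ∂μ ≤
      ∫ x, (ψ (shift^[h] x) + ψ x + ε') ∂μ := by
    refine integral_mono_ae ((integrable_const _).indicator hU) hi2 ?_
    filter_upwards [iterate_eigen hμ hc h, hfr] with x h1 h2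
    by_cases hx : x ∈ U
    · simp only [Set.indicator_of_mem hx]
      have h3 : dist (g (shift^[h] x)) (g x) < ε' :=
        hL _ _ fun i hi => by rw [shift_iterate]; exact (hx i hi).symm
      rw [dist_eq_norm] at h3
      calc ‖c ^ h - 1‖ * r = ‖f (shift^[h] x) - f x‖ := by
            rw [h1, ← h2, ← norm_mul]; congr 1; ring
        _ = ‖(f (shift^[h] x) - g (shift^[h] x)) - (f x - g x) +
              (g (shift^[h] x) - g x)‖ := by congr 1; ring
        _ ≤ _ := (norm_add_le _ _).trans (add_le_add (norm_sub_le _ _) h3.le)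
    · simp only [Set.indicator_of_notMem hx]
      simp only [ψ]
      positivity
  have hi1 : Integrable (fun x => ψ (shift^[h] x) + ψ x) μ := hψs.add hψ
  rw [integral_indicator_const _ hU, integral_add hi1 (integrable_const _),
    integral_add hψs hψ, heq] at hle
  simp only [integral_const, probReal_univ, smul_eq_mul, one_mul] at hle
  have h5 : δ * (‖c ^ h - 1‖ * r) ≤ 3 * ε' :=
    (mul_le_mul_of_nonneg_right hh (by positivity)).trans (by linarith)
  have h6 : 3 * ε' = δ * (ε * r) := by simp only [ε']; ring
  rw [h6] at h5
  exact le_of_mul_le_mul_right (le_of_mul_le_mul_left h5 hδ) hr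

end Eigenfunction

section Matrices

open Matrix

/-- The abelianization of `χ_κ`: row `b` counts the letters of `χ_κ(b)`. -/
def incidence (κ : ℕ) : Matrix (Fin 3) (Fin 3) ℤ := !![0, 1, 0; κ, 0, 1; κ - 1, 0, 1]

/-- The inverse of `incidence κ`. -/
def incidenceInv (κ : ℕ) : Matrix (Fin 3) (Fin 3) ℤ := !![0, 1, -1; 1, 0, 0; 0, 1 - κ, κ]

/-- A nonnegative conjugate of `incidenceInv κ`. -/
def dualIncidence (κ : ℕ) : Matrix (Fin 3) (Fin 3) ℤ := !![κ - 1, κ, κ - 1; 1, 0, 0; 0, 1, 1]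

/-- The incidence matrix of `χ_{k (n+1)} ∘ ⋯ ∘ χ_{k (n+l)}`. -/
def incProd (k : ℕ → ℕ) : ℕ → ℕ → Matrix (Fin 3) (Fin 3) ℤ
  | _, 0 => 1
  | n, l + 1 => incProd k (n + 1) l * incidence (k (n + 1))

/-- The inverse of `incProd`. -/
def incInvProd (k : ℕ → ℕ) : ℕ → ℕ → Matrix (Fin 3) (Fin 3) ℤ
  | _, 0 => 1
  | n, l + 1 => incidenceInv (k (n + 1)) * incInvProd k (n + 1) l

/-- The product of the matrices `dualIncidence`. -/
def dualProd (k : ℕ → ℕ) : ℕ → ℕ → Matrix (Fin 3) (Fin 3) ℤ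
  | _, 0 => 1
  | n, l + 1 => dualIncidence (k (n + 1)) * dualProd k (n + 1) l

/-- Lengths of the level-`n` blocks, as an integer vector. -/
def lenVec (k : ℕ → ℕ) (n : ℕ) : Fin 3 → ℤ := fun a => wlen k n a

variable {k : ℕ → ℕ}

lemma incidenceInv_mul_incidence (κ : ℕ) : incidenceInv κ * incidence κ = 1 := by
  ext i j
  fin_cases i <;> fin_cases j <;> simp [incidence, incidenceInv, Matrix.mul_apply, Fin.sum_univ_three]
  ring

lemma det_incidence (κ : ℕ) : (incidence κ).det = -1 := by
  simp [incidence, det_fin_three]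
  ring

lemma incInvProd_mul_incProd (k : ℕ → ℕ) (n l : ℕ) : incInvProd k n l * incProd k n l = 1 := by
  induction l generalizing n with
  | zero => simp [incInvProd, incProd]
  | succ l ih =>
    rw [incInvProd, incProd, Matrix.mul_assoc, ← Matrix.mul_assoc (incInvProd k (n + 1) l), ih,
      Matrix.one_mul, incidenceInv_mul_incidence]

lemma det_incProd (k : ℕ → ℕ) (n l : ℕ) : (incProd k n l).det = (-1) ^ l := by
  induction l generalizing n with
  | zero => simp [incProd]
  | succ l ih => rw [incProd, det_mul, ih, det_incidence, pow_succ]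

lemma trace_incInvProd (k : ℕ → ℕ) (n l : ℕ) :
    (incInvProd k n l).trace = (dualProd k n l).trace := by
  set S : Matrix (Fin 3) (Fin 3) ℤ := !![-1, 1, -1; 1, -1, 0; 0, 1, 0]
  set T : Matrix (Fin 3) (Fin 3) ℤ := !![0, 1, 1; 0, 0, 1; -1, -1, 0]
  have hST : S * T = 1 := by decide
  have hTS : T * S = 1 := by decide
  have hB : ∀ κ, dualIncidence κ = S * incidenceInv κ * T := by
    intro κ
    ext i j
    fin_cases i <;> fin_cases j <;>
      simp [S, T, dualIncidence, incidenceInv, Matrix.mul_apply, Fin.sum_univ_three]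
    all_goals ring
  have key : ∀ n, dualProd k n l = S * incInvProd k n l * T := by
    induction l with
    | zero => intro n; simp [dualProd, incInvProd, hST]
    | succ l ih =>
      intro n
      rw [dualProd, incInvProd, ih, hB]
      calc _ = S * incidenceInv (k (n + 1)) * (T * S) * incInvProd k (n + 1) l * T := by
            simp only [Matrix.mul_assoc]
        _ = _ := by rw [hTS]; simp only [Matrix.mul_assoc, Matrix.one_mul]
  rw [key, Matrix.trace_mul_comm, ← Matrix.mul_assoc, hTS, Matrix.one_mul]

lemma incidence_nonneg {κ : ℕ} (h : 1 ≤ κ) (i j : Fin 3) : 0 ≤ incidence κ i j := by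
  fin_cases i <;> fin_cases j <;> simp [incidence]
  exact_mod_cast h

lemma dualIncidence_eq (κ : ℕ) (i j : Fin 3) :
    dualIncidence κ i j = incidence κ j i + if i = 0 ∧ j = 0 then (κ - 1 : ℤ) else 0 := by
  fin_cases i <;> fin_cases j <;> simp [incidence, dualIncidence]

lemma incProd_nonneg (hpos : ∀ i, 1 ≤ i → 1 ≤ k i) (n l : ℕ) (i j : Fin 3) :
    0 ≤ incProd k n l i j := by
  induction l generalizing n i j with
  | zero => rw [incProd, Matrix.one_apply]; positivity
  | succ l ih =>
    rw [incProd, Matrix.mul_apply]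
    exact Finset.sum_nonneg fun c _ => mul_nonneg (ih _ _ _)
      (incidence_nonneg (hpos _ (by omega)) _ _)

lemma le_incidence_of_mem {κ : ℕ} {a b : Fin 3} (h : a ∈ chiSub κ b) : 0 < incidence κ b a := by
  fin_cases b <;> fin_cases a <;> simp_all [chiSub, incidence] <;> omega

lemma Reach.incProd_pos (hpos : ∀ i, 1 ≤ i → 1 ≤ k i) {n l : ℕ} {a b : Fin 3}
    (h : Reach k n l b a) : 0 < incProd k n l b a := by
  induction l generalizing n a with
  | zero =>
    have : a = b := by simpa [Reach, compApply] using h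
    subst this
    simp [incProd]
  | succ l ih =>
    rw [Reach, add_comm l 1, compApply_add, compApply_eq_flatMap, List.mem_flatMap] at h
    obtain ⟨c, hc, hac⟩ := h
    have h1 : Reach k (n + 1) l b c := by simpa only [Reach, add_assoc] using hc
    have h2 : a ∈ chiSub (k (n + 1)) c := by simpa [compApply, applyChi] using hac
    rw [incProd, Matrix.mul_apply]
    refine Finset.sum_pos' (fun c _ => mul_nonneg (incProd_nonneg hpos _ _ _ _)
      (incidence_nonneg (hpos _ (by omega)) _ _)) ⟨c, Finset.mem_univ _, ?_⟩
    exact mul_pos (ih h1) (le_incidence_of_mem h2)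

lemma incProd_add_le_dualProd (hpos : ∀ i, 1 ≤ i → 1 ≤ k i) (n l : ℕ)
    (h : ∀ i j, incProd k (n + 1) l j i ≤ dualProd k (n + 1) l i j) (i j : Fin 3) :
    incProd k n (l + 1) j i + (if i = 0 then (k (n + 1) - 1) * incProd k (n + 1) l j 0 else 0) ≤
      dualProd k n (l + 1) i j := by
  have hκ : (1 : ℤ) ≤ k (n + 1) := by exact_mod_cast hpos (n + 1) (by omega)
  have h0 := mul_le_mul_of_nonneg_left (h 0 j) (sub_nonneg.2 hκ)
  have h1 : ∀ c, incProd k (n + 1) l j c * incidence (k (n + 1)) c i ≤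
      incidence (k (n + 1)) c i * dualProd k (n + 1) l c j := fun c => by
    rw [mul_comm]
    exact mul_le_mul_of_nonneg_left (h c j) (incidence_nonneg (hpos _ (by omega)) _ _)
  have h2 := Finset.sum_le_sum fun c (_ : c ∈ Finset.univ) => h1 c
  rw [incProd, dualProd, Matrix.mul_apply, Matrix.mul_apply]
  simp only [dualIncidence_eq, add_mul, Finset.sum_add_distrib]
  refine add_le_add h2 ?_
  by_cases hi : i = 0
  · simpa [hi] using h0
  · simp [hi]

lemma incProd_le_dualProd (hpos : ∀ i, 1 ≤ i → 1 ≤ k i) (n l : ℕ) (i j : Fin 3) :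
    incProd k n l j i ≤ dualProd k n l i j := by
  induction l generalizing n i j with
  | zero => simp [incProd, dualProd, Matrix.one_apply, eq_comm]
  | succ l ih =>
    refine le_trans ?_ (incProd_add_le_dualProd hpos n l (ih (n + 1)) i j)
    have hκ : (1 : ℤ) ≤ k (n + 1) := by exact_mod_cast hpos (n + 1) (by omega)
    have := mul_nonneg (sub_nonneg.2 hκ) (incProd_nonneg hpos (n + 1) l j 0)
    split_ifs <;> simp [this]

lemma trace_incProd_lt (hpos : ∀ i, 1 ≤ i → 1 ≤ k i) {n l : ℕ} (hk : 1 < k (n + 1))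
    (h : Reach k (n + 1) l 0 0) : (incProd k n (l + 1)).trace < (incInvProd k n (l + 1)).trace := by
  rw [trace_incInvProd, trace_fin_three, trace_fin_three]
  have h0 := incProd_add_le_dualProd hpos n l (incProd_le_dualProd hpos (n + 1) l) 0 0
  have h1 := incProd_le_dualProd hpos n (l + 1) 1 1
  have h2 := incProd_le_dualProd hpos n (l + 1) 2 2
  have h3 := h.incProd_pos hpos
  have hκ : (1 : ℤ) < k (n + 1) := by exact_mod_cast hk
  have h4 := mul_pos (sub_pos.2 hκ) h3
  simp only [if_true] at h0
  linarith

lemma trace_incProd_pos (hpos : ∀ i, 1 ≤ i → 1 ≤ k i) (n l : ℕ) :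
    0 < (incProd k n l).trace := by
  rw [trace_fin_three]
  have h2 := (reach_two_two k n l).incProd_pos hpos
  have h0 := incProd_nonneg hpos n l 0 0
  have h1 := incProd_nonneg hpos n l 1 1
  linarith

lemma lenVec_succ (hpos : ∀ i, 1 ≤ i → 1 ≤ k i) (n : ℕ) :
    lenVec k (n + 1) = incidence (k (n + 1)) *ᵥ lenVec k n := by
  have h := hpos (n + 1) (by omega)
  funext a
  fin_cases a
  · simp [lenVec, incidence, Matrix.mulVec, dotProduct, Fin.sum_univ_three, wlen_succ_zero]
  · simp [lenVec, incidence, Matrix.mulVec, dotProduct, Fin.sum_univ_three, wlen_succ_one]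
    ring
  · simp [lenVec, incidence, Matrix.mulVec, dotProduct, Fin.sum_univ_three, wlen_succ_two,
      Nat.cast_sub h]
    ring

lemma lenVec_add (hpos : ∀ i, 1 ≤ i → 1 ≤ k i) (n l : ℕ) :
    lenVec k (n + l) = incProd k n l *ᵥ lenVec k n := by
  induction l generalizing n with
  | zero => simp [incProd]
  | succ l ih =>
    rw [incProd, ← Matrix.mulVec_mulVec, ← lenVec_succ hpos, ← ih]
    congr 1; omega

lemma incProd_congr {n n' : ℕ} (h : ∀ i, 1 ≤ i → k (n + i) = k (n' + i)) (l : ℕ) :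
    incProd k n l = incProd k n' l := by
  induction l generalizing n n' with
  | zero => rfl
  | succ l ih =>
    rw [incProd, incProd, h 1 le_rfl, ih fun i hi => ?_]
    simpa only [add_assoc, add_comm 1] using h (i + 1) (by omega)

lemma mul_mul_self_fin_three (M : Matrix (Fin 3) (Fin 3) ℤ) :
    M * M * M = M.trace • (M * M) - M.adjugate.trace • M + M.det • 1 := by
  obtain ⟨a, b, c, d, e, f, g, h, l, rfl⟩ : ∃ a b c d e f g h l, M = !![a, b, c; d, e, f; g, h, l] :=
    ⟨_, _, _, _, _, _, _, _, _, M.eta_fin_three⟩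
  have h1 : (1 : Matrix (Fin 3) (Fin 3) ℤ) = !![1, 0, 0; 0, 1, 0; 0, 0, 1] := by decide
  rw [adjugate_fin_three_of, trace_fin_three_of, trace_fin_three_of, det_fin_three, h1]
  simp only [mul_fin_three, Matrix.smul_of, Matrix.smul_cons, Matrix.smul_empty, smul_eq_mul]
  ext i j
  fin_cases i <;> fin_cases j <;> simp <;> ring

/-- Cayley–Hamilton for an invertible `3 × 3` matrix with determinant one. -/
lemma cayleyHamilton_three {M N : Matrix (Fin 3) (Fin 3) ℤ} (hNM : N * M = 1) (hdet : M.det = 1) :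
    M * M * M = M.trace • (M * M) - N.trace • M + 1 := by
  have hN : N = M.adjugate := by
    have h1 := Matrix.mul_adjugate M
    rw [hdet, one_smul] at h1
    rw [← Matrix.mul_one N, ← h1, ← Matrix.mul_assoc, hNM, Matrix.one_mul]
  have := mul_mul_self_fin_three M
  rwa [hdet, one_smul, ← hN] at this

lemma exists_wlen_recurrence (hpos : ∀ i, 1 ≤ i → 1 ≤ k i) {n l : ℕ} (hk : 1 < k (n + 1))
    (hper : ∀ i, n < i → k (i + (l + 1)) = k i) (heven : Even (l + 1))
    (h : Reach k (n + 1) l 0 0) :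
    ∃ t s : ℤ, 0 < t ∧ t < s ∧ ∀ a j,
      (wlen k (n + (l + 1) * (j + 3)) a : ℤ) = t * wlen k (n + (l + 1) * (j + 2)) a -
        s * wlen k (n + (l + 1) * (j + 1)) a + wlen k (n + (l + 1) * j) a := by
  set M := incProd k n (l + 1)
  have hper' : ∀ j i, 1 ≤ i → k (n + (l + 1) * j + i) = k (n + i) := by
    intro j i hi
    have := eq_add_mul_of_periodic (m := n + 1) (fun i hi => hper i hi) (i := n + i)
      (by omega) j
    rw [← this]; congr 1; omega
  have hM : ∀ j, lenVec k (n + (l + 1) * (j + 1)) = M *ᵥ lenVec k (n + (l + 1) * j) := by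
    intro j
    rw [mul_add, mul_one, ← add_assoc, lenVec_add hpos, incProd_congr (hper' j)]
  refine ⟨M.trace, (incInvProd k n (l + 1)).trace, trace_incProd_pos hpos _ _,
    trace_incProd_lt hpos hk h, fun a j => ?_⟩
  have hCH := cayleyHamilton_three (incInvProd_mul_incProd k n (l + 1))
    (by rw [det_incProd, heven.neg_one_pow])
  have h1 : lenVec k (n + (l + 1) * (j + 3)) = (M * M * M) *ᵥ lenVec k (n + (l + 1) * j) := by
    rw [← Matrix.mulVec_mulVec, ← Matrix.mulVec_mulVec, ← hM, ← hM, ← hM]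
  have h2 : lenVec k (n + (l + 1) * (j + 2)) = (M * M) *ᵥ lenVec k (n + (l + 1) * j) := by
    rw [← Matrix.mulVec_mulVec, ← hM, ← hM]
  rw [hCH, Matrix.add_mulVec, Matrix.sub_mulVec, Matrix.smul_mulVec, Matrix.smul_mulVec, ← h2,
    ← hM, Matrix.one_mulVec] at h1
  simpa [lenVec] using congrFun h1 a

end Matrices

section Cubic

open Polynomial

variable {t s : ℤ} {lam : ℝ}

lemma exists_cubic_root (hts : t < s) :
    ∃ x : ℝ, 0 < x ∧ x < 1 ∧ x ^ 3 - t * x ^ 2 + s * x - 1 = 0 := by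
  have hts' : (t : ℝ) < s := by exact_mod_cast hts
  have hc : ContinuousOn (fun x : ℝ => x ^ 3 - t * x ^ 2 + s * x - 1) (Set.Icc 0 1) := by fun_prop
  obtain ⟨x, hx, hx0⟩ := intermediate_value_Ioo zero_le_one hc
    (show (0 : ℝ) ∈ _ by constructor <;> norm_num; linarith)
  exact ⟨x, hx.1, hx.2, hx0⟩

/-- The root is of degree three over the rationals. -/
lemma quadratic_coeff_eq_zero (ht : 0 < t) (hts : t < s)
    (hlam : lam ^ 3 - t * lam ^ 2 + s * lam - 1 = 0) {a b c : ℤ}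
    (h : a * lam ^ 2 + b * lam + c = 0) : a = 0 := by
  set F : ℤ[X] := X ^ 3 + (C (-t) * X ^ 2 + C s * X + C (-1)) with hF
  have hdeg : (C (-t) * X ^ 2 + C s * X + C (-1) : ℤ[X]).degree < (3 : ℕ) :=
    degree_quadratic_lt
  have hmon : F.Monic := monic_X_pow_add hdeg
  have hnat : F.natDegree = 3 := by rw [hF]; compute_degree!
  have hirr : Irreducible F := by
    rw [hmon.irreducible_iff_roots_eq_zero_of_degree_le_three (by omega) (by omega)]
    refine Multiset.eq_zero_of_forall_notMem fun r hr => ?_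
    have h1 : r ^ 3 - t * r ^ 2 + s * r - 1 = 0 := by
      have := (mem_roots'.1 hr).2
      simp only [IsRoot.def, hF, eval_add, eval_mul, eval_pow, eval_X, eval_C] at this
      linarith
    have h2 : r * (r ^ 2 - t * r + s) = 1 := by linarith
    rcases Int.eq_one_or_neg_one_of_mul_eq_one h2 with rfl | rfl <;> linarith
  have hroot : aeval lam F = 0 := by
    simp only [hF, map_add, map_mul, map_pow, aeval_X, aeval_C, algebraMap_int_eq,
      Int.coe_castRingHom]
    push_cast
    linarith
  have hint : IsIntegral ℤ lam := ⟨F, hmon, hroot⟩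
  have hmin : minpoly ℤ lam = F := by
    have hd := minpoly.isIntegrallyClosed_dvd hint hroot
    have ha := (minpoly.irreducible hint).associated_of_dvd hirr hd
    exact eq_of_monic_of_associated (minpoly.monic hint) hmon ha
  have hq : aeval lam (C a * X ^ 2 + C b * X + C c : ℤ[X]) = 0 := by
    simp only [map_add, map_mul, map_pow, aeval_X, aeval_C, algebraMap_int_eq,
      Int.coe_castRingHom]
    exact h
  have hdvd := minpoly.isIntegrallyClosed_dvd hint hq
  rw [hmin] at hdvd
  have h0 : (C a * X ^ 2 + C b * X + C c : ℤ[X]) = 0 := by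
    by_contra hne
    have h3 := natDegree_le_of_dvd hdvd hne
    have h4 := natDegree_quadratic_le (a := a) (b := b) (c := c)
    omega
  have h2 := congrArg (fun p : ℤ[X] => p.coeff 2) h0
  simpa only [coeff_add, coeff_C_mul, coeff_X_pow, coeff_X, coeff_C, coeff_zero, if_true,
    OfNat.ofNat_ne_one, OfNat.ofNat_ne_zero, OfNat.one_ne_ofNat, if_false, mul_zero, mul_one,
    add_zero] using h2

lemma abs_tendsto_absurd {y : ℕ → ℝ} {β : ℝ} (hβ : 1 ≤ β) (hy : ∀ j, |y (j + 1)| = β * |y j|)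
    (h : Tendsto y atTop (𝓝 0)) : y 0 = 0 := by
  have hmono : ∀ j, |y 0| ≤ |y j| := by
    intro j
    induction j with
    | zero => rfl
    | succ j ih => rw [hy]; nlinarith [abs_nonneg (y j)]
  have := ge_of_tendsto' h.abs hmono
  simpa using this

/-- A second order recurrence whose characteristic roots lie outside the unit disc. -/
lemma second_order_eq_zero {α β : ℝ} (hα : 0 < α) (hβ : 1 < β) (hαβ : α < 1 + β) {y : ℕ → ℝ}
    (hy : ∀ j, y (j + 2) = α * y (j + 1) - β * y j) (h : Tendsto y atTop (𝓝 0)) : y 0 = 0 := by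
  set D : ℕ → ℝ := fun j => y (j + 1) ^ 2 - α * y j * y (j + 1) + β * y j ^ 2
  have h1 : Tendsto (fun j => y (j + 1)) atTop (𝓝 0) := (tendsto_add_atTop_iff_nat 1).2 h
  have hDlim : Tendsto D atTop (𝓝 0) := by
    have := ((h1.pow 2).sub ((h.const_mul α).mul h1)).add ((h.pow 2).const_mul β)
    simpa using this
  have hDrec : ∀ j, D (j + 1) = β * D j := fun j => by
    simp only [D, add_assoc, one_add_one_eq_two, hy j]; ring
  have hD0 : D 0 = 0 := abs_tendsto_absurd hβ.le (fun j => by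
    rw [hDrec, abs_mul, abs_of_pos (by linarith)]) hDlim
  by_contra h0
  set r := y 1 / y 0
  have hr1 : y 1 = r * y 0 := by simp only [r]; field_simp
  have hr : r ^ 2 - α * r + β = 0 := by
    have h2 : (r ^ 2 - α * r + β) * y 0 ^ 2 = 0 := by
      rw [← hD0]; simp only [D, zero_add, hr1]; ring
    exact (mul_eq_zero.1 h2).resolve_right (pow_ne_zero 2 h0)
  have hgeom : ∀ j, y (j + 1) = r * y j := by
    intro j
    induction j with
    | zero => exact hr1
    | succ j ih =>
      rw [add_assoc, one_add_one_eq_two, hy, ih]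
      linear_combination (-y j) * hr
  have hr0 : 0 < r := by nlinarith [sq_nonneg r]
  rcases le_or_gt 1 r with h3 | h3
  · exact h0 (abs_tendsto_absurd h3 (fun j => by
      rw [hgeom, abs_mul, abs_of_pos hr0]) h)
  · have h4 : r * (1 - α + β) = (r - β) * (1 - r) := by linear_combination hr
    have h5 : 0 < r * (1 - α + β) := mul_pos hr0 (by linarith)
    have h6 : (r - β) * (1 - r) < 0 := mul_neg_of_neg_of_pos (by linarith) (by linarith)
    linarith

lemma third_order_eq_mul (ht : 0 < t) (hts : t < s) (h0 : 0 < lam) (h1 : lam < 1)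
    (hlam : lam ^ 3 - t * lam ^ 2 + s * lam - 1 = 0) {x : ℕ → ℝ}
    (hx : ∀ j, x (j + 3) = t * x (j + 2) - s * x (j + 1) + x j) (h : Tendsto x atTop (𝓝 0))
    (j : ℕ) : x (j + 1) = lam * x j := by
  have ht' : (1 : ℝ) ≤ t := by exact_mod_cast ht
  have hts' : (t : ℝ) < s := by exact_mod_cast hts
  set β := s - lam * (t - lam)
  have hβ : lam * β = 1 := by simp only [β]; linear_combination hlam
  have key := second_order_eq_zero (α := t - lam) (β := β) (by linarith)
    (by by_contra! hc; nlinarith) (by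
      have : (1 - lam) * (1 + β - (t - lam)) = s - t := by linear_combination -hβ
      by_contra! hc
      nlinarith) (y := fun i => x (j + i + 1) - lam * x (j + i)) (fun i => by
      have := hx (j + i)
      simp only [← add_assoc, show j + i + 2 + 1 = j + i + 3 by ring,
        show j + i + 1 + 1 = j + i + 2 by ring, β] at *
      linear_combination this - x (j + i) * hlam) (by
      have e : ∀ l, Tendsto (fun i => x (j + i + l)) atTop (𝓝 0) := fun l => by
        have := (tendsto_add_atTop_iff_nat (j + l)).2 h
        refine this.congr fun i => ?_
        congr 1; ring
      simpa using (e 1).sub ((e 0).const_mul lam))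
  simp only [add_zero] at key
  linarith

lemma Int.eventually_eq_zero_of_tendsto {e : ℕ → ℤ}
    (h : Tendsto (fun j => (e j : ℝ)) atTop (𝓝 0)) : ∀ᶠ j in atTop, e j = 0 := by
  filter_upwards [Metric.tendsto_nhds.1 h 1 one_pos] with j hj
  rw [Real.dist_eq, sub_zero, ← Int.cast_abs] at hj
  exact Int.abs_lt_one_iff.1 (by exact_mod_cast hj)

/-- If `θ ψ_j` approaches the integers along a recurrence with one contracting root, then it is
eventually an integer. -/
lemma eventually_mul_eq_int (ht : 0 < t) (hts : t < s) {ψ : ℕ → ℤ} (hψ : ∀ j, 0 < ψ j)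
    (hrec : ∀ j, ψ (j + 3) = t * ψ (j + 2) - s * ψ (j + 1) + ψ j) {θ : ℝ}
    (h : Tendsto (fun j => θ * ψ j - round (θ * ψ j)) atTop (𝓝 0)) :
    ∀ᶠ j in atTop, θ * ψ j = round (θ * ψ j) := by
  obtain ⟨lam, h0, h1, hlam⟩ := exists_cubic_root hts
  set m : ℕ → ℤ := fun j => round (θ * ψ j)
  set x : ℕ → ℝ := fun j => θ * ψ j - m j
  have hs : ∀ l, Tendsto (fun j => x (j + l)) atTop (𝓝 0) := fun l =>
    (tendsto_add_atTop_iff_nat l).2 h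
  have hm : ∀ᶠ j in atTop, m (j + 3) - t * m (j + 2) + s * m (j + 1) - m j = 0 := by
    refine Int.eventually_eq_zero_of_tendsto ?_
    have := ((((hs 3).sub ((hs 2).const_mul (t : ℝ))).add
      ((hs 1).const_mul (s : ℝ))).sub (hs 0)).neg
    simp only [mul_zero, sub_zero, add_zero, neg_zero] at this
    refine this.congr fun j => ?_
    simp only [x]
    have hr : (ψ (j + 3) : ℝ) = t * ψ (j + 2) - s * ψ (j + 1) + ψ j := by exact_mod_cast hrec j
    rw [hr]; push_cast; ring
  obtain ⟨J, hJ⟩ := eventually_atTop.1 hm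
  have hx : ∀ j ≥ J, x (j + 1) = lam * x j := by
    intro j hj
    obtain ⟨i, rfl⟩ := Nat.exists_eq_add_of_le hj
    refine third_order_eq_mul ht hts h0 h1 hlam (x := fun i => x (J + i)) (fun i => ?_)
      ((hs J).congr fun i => by rw [add_comm]) i
    have hr : (ψ (J + i + 3) : ℝ) = t * ψ (J + i + 2) - s * ψ (J + i + 1) + ψ (J + i) := by
      exact_mod_cast hrec (J + i)
    have hm' : (m (J + i + 3) : ℝ) - t * m (J + i + 2) + s * m (J + i + 1) - m (J + i) = 0 := by
      exact_mod_cast hJ (J + i) (by omega)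
    simp only [x, ← add_assoc, hr]
    linear_combination -hm'
  have hcross : ∀ i ≥ J, ∀ j ≥ J, ψ i * m j = ψ j * m i := by
    intro i hi j hj
    have e1 := hx i hi
    have e2 := hx j hj
    simp only [x] at e1 e2
    have := quadratic_coeff_eq_zero ht hts hlam (a := ψ i * m j - ψ j * m i)
      (b := -(ψ (i + 1) * m j) - ψ i * m (j + 1) + ψ (j + 1) * m i + ψ j * m (i + 1))
      (c := ψ (i + 1) * m (j + 1) - ψ (j + 1) * m (i + 1)) (by
        push_cast
        linear_combination (ψ (j + 1) - lam * ψ j) * e1 - (ψ (i + 1) - lam * ψ i) * e2)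
    linarith
  filter_upwards [eventually_ge_atTop J] with j hj
  have hle : ∀ᶠ i in atTop, |x j| ≤ |ψ j * x i| := by
    filter_upwards [eventually_ge_atTop J] with i hi
    have hc : (ψ i * m j : ℝ) = ψ j * m i := by exact_mod_cast hcross i hi j hj
    have e : ψ j * x i = ψ i * x j := by simp only [x]; linear_combination hc
    have h1 : (1 : ℝ) ≤ ψ i := by exact_mod_cast hψ i
    rw [e, abs_mul, abs_of_pos (a := (ψ i : ℝ)) (by linarith)]
    exact le_mul_of_one_le_left (abs_nonneg _) h1
  have hlim : Tendsto (fun i => |ψ j * x i|) atTop (𝓝 0) := by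
    simpa using ((hs 0).const_mul (ψ j : ℝ)).abs
  have := ge_of_tendsto hlim hle
  have := abs_nonpos_iff.1 this
  simp only [x] at this
  linarith

lemma abs_sub_round_le_norm_exp (θ : ℝ) :
    |θ - round θ| ≤ ‖Complex.exp (2 * Real.pi * θ * Complex.I) - 1‖ := by
  set y := θ - round θ with hy
  have e : Complex.exp (2 * Real.pi * θ * Complex.I) =
      Complex.exp (Complex.I * (2 * Real.pi * y : ℝ)) := by
    rw [Complex.exp_eq_exp_iff_exists_int]
    refine ⟨round θ, ?_⟩
    simp only [hy]; push_cast; ring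
  rw [e, Complex.norm_exp_I_mul_ofReal_sub_one, norm_mul, Real.norm_eq_abs, Real.norm_eq_abs,
    show 2 * Real.pi * y / 2 = Real.pi * y by ring]
  have h1 : |Real.pi * y| ≤ Real.pi / 2 := by
    rw [abs_mul, abs_of_pos Real.pi_pos]
    have := abs_sub_round θ
    nlinarith [Real.pi_pos]
  have h2 := Real.mul_abs_le_abs_sin h1
  rw [abs_mul, abs_of_pos Real.pi_pos, ← mul_assoc, div_mul_cancel₀ _ Real.pi_ne_zero] at h2
  rw [abs_of_pos (two_pos (α := ℝ))]
  linarith [abs_nonneg y]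

/-- A unimodular number whose powers along such a recurrence tend to one has eventually trivial
powers. -/
lemma eventually_pow_eq_one (ht : 0 < t) (hts : t < s) {ψ : ℕ → ℕ} (hψ : ∀ j, 0 < ψ j)
    (hrec : ∀ j, (ψ (j + 3) : ℤ) = t * ψ (j + 2) - s * ψ (j + 1) + ψ j) {c : ℂ} (hc : ‖c‖ = 1)
    (h : Tendsto (fun j => ‖c ^ ψ j - 1‖) atTop (𝓝 0)) : ∀ᶠ j in atTop, c ^ ψ j = 1 := by
  obtain ⟨θ, hθ⟩ : ∃ θ : ℝ, c = Complex.exp (2 * Real.pi * θ * Complex.I) := by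
    obtain ⟨θ, hθ⟩ := (Complex.norm_eq_one_iff c).1 hc
    refine ⟨θ / (2 * Real.pi), ?_⟩
    rw [← hθ]
    congr 1
    have : (Real.pi : ℂ) ≠ 0 := by exact_mod_cast Real.pi_ne_zero
    push_cast; field_simp
  have hpow : ∀ n : ℕ, c ^ n = Complex.exp (2 * Real.pi * (θ * n : ℝ) * Complex.I) := by
    intro n
    rw [hθ, ← Complex.exp_nat_mul]
    congr 1; push_cast; ring
  have hlim : Tendsto (fun j => θ * ((ψ j : ℕ) : ℤ) - round (θ * ((ψ j : ℕ) : ℤ))) atTop (𝓝 0) := by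
    refine squeeze_zero_norm (fun j => ?_) h
    rw [hpow]
    exact abs_sub_round_le_norm_exp (θ * ψ j)
  have := eventually_mul_eq_int ht hts (ψ := fun j => (ψ j : ℤ))
    (fun j => by exact_mod_cast hψ j) hrec hlim
  filter_upwards [this] with j hj
  rw [hpow]
  push_cast at hj
  rw [hj, Complex.exp_eq_one_iff]
  exact ⟨round (θ * ψ j), by push_cast; ring⟩

end Cubic

section WeakMixing

variable {k : ℕ → ℕ} {ρ : ℕ → Fin 3}

lemma eq_one_of_pow_wlen_eq_one (hpos : ∀ i, 1 ≤ i → 1 ≤ k i) {c : ℂ} (n : ℕ)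
    (h : ∀ a, c ^ wlen k n a = 1) : c = 1 := by
  induction n with
  | zero => simpa [wlen, compApply] using h 0
  | succ n ih =>
    refine ih fun a => ?_
    have hk := hpos (n + 1) (by omega)
    have h0 := h 0
    have h1 := h 1
    have h2 := h 2
    rw [wlen_succ_zero] at h0
    obtain ⟨d, hd⟩ : ∃ d, k (n + 1) = d + 1 := ⟨k (n + 1) - 1, by omega⟩
    rw [wlen_succ_one, hd, add_mul, one_mul, ← add_assoc, pow_add] at h1
    rw [wlen_succ_two, hd, add_tsub_cancel_right] at h2
    rw [h2, one_mul] at h1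
    rw [pow_add, mul_comm d, pow_mul, h1, one_pow, mul_one] at h2
    fin_cases a
    exacts [h1, h0, h2]

lemma exists_isUniqueInvProb (hρ : ∀ n, IsPrefixSeq (compApply k n [2]) ρ)
    (hlen : ∀ j, ∃ N, ∀ n ≥ N, ∀ a, j ≤ wlen k n a) {n1 q K : ℕ}
    (hq : ∀ n ≥ n1, ∀ a b, Reach k n q b a)
    (hK : ∀ n ≥ n1, ∀ a b, wlen k (n + q) b ≤ K * wlen k n a) :
    ∃! μ : Measure (ℕ → Fin 3), IsInvProb (orbitClosure ρ) μ := by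
  have havg : ∀ g : (ℕ → Fin 3) → ℝ, Continuous g → ∃ A : ℝ, ∀ ε > 0, ∃ D : ℝ,
      ∀ x ∈ orbitClosure ρ, ∀ N : ℕ,
        |∑ j ∈ Finset.range N, g (shift^[j] x) - A * N| ≤ ε * N + D := by
    intro g hg
    refine exists_uniform_orbit_average hg (exists_uniform_average
      (C := ‖BoundedContinuousFunction.mkOfCompact ⟨g, hg⟩‖) hρ hlen hq hK (fun j => ?_)
      (windowContinuous_of_continuous hg))
    exact (BoundedContinuousFunction.mkOfCompact ⟨g, hg⟩).norm_coe_le_norm _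
  obtain ⟨μ, hμ⟩ := exists_isInvProb ρ
  exact ⟨μ, hμ, fun ν hν => hν.unique havg hμ⟩

lemma pow_wlen_near_one {μ : Measure (ℕ → Fin 3)} (hμ : IsInvProb (orbitClosure ρ) μ)
    (herg : Ergodic shift μ) (hρ : ∀ n, IsPrefixSeq (compApply k n [2]) ρ)
    (hlen : ∀ j, ∃ N, ∀ n ≥ N, ∀ a, j ≤ wlen k n a) {n1 q K : ℕ}
    (hq : ∀ n ≥ n1, ∀ a b, Reach k n q b a)
    (hK : ∀ n ≥ n1, ∀ a b, wlen k (n + (q + 2)) b ≤ K * wlen k n a)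
    {f : (ℕ → Fin 3) → ℂ} {c : ℂ} (hf : AEMeasurable f μ) (hf0 : ¬ f =ᵐ[μ] 0)
    (hc : (fun x => f (shift x)) =ᵐ[μ] fun x => c * f x) {ε : ℝ} (hε : 0 < ε) :
    ∃ N, ∀ n ≥ N, ∀ a, ‖c ^ wlen k n a - 1‖ ≤ ε := by
  have hK0 : (0 : ℝ) < K := by
    rcases Nat.eq_zero_or_pos K with rfl | h
    · have := hK n1 le_rfl 0 0
      have := wlen_pos k (n1 + (q + 2)) 0
      omega
    · exact_mod_cast h
  obtain ⟨L, hL⟩ := eigenvalue_pow_near_one hμ herg hf hf0 hc (δ := 1 / (8 * K)) (by positivity) hε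
  obtain ⟨N, hN⟩ := hlen (2 * L)
  refine ⟨n1 + N + 2, fun n hn a => ?_⟩
  obtain ⟨d, rfl⟩ : ∃ d, n = d + 2 := ⟨n - 2, by omega⟩
  exact hL _ (hμ.le_measure_agreeSet hρ hlen (hq _ (by omega)) (hK d (by omega) 2)
    (hN d (by omega) 2) a)

lemma eigenvalue_eq_one (hpos : ∀ i, 1 ≤ i → 1 ≤ k i) {m p P n1 : ℕ} (hp : 1 ≤ p)
    (hper : ∀ i, m ≤ i → k (i + p) = k i) (hgap : ∀ n ≥ n1, ∃ j < P, 1 < k (n + 2 * j + 1))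
    {c : ℂ} (hc : ‖c‖ = 1) (h : ∀ ε > 0, ∃ N, ∀ n ≥ N, ∀ a, ‖c ^ wlen k n a - 1‖ ≤ ε) :
    c = 1 := by
  obtain ⟨j0, -, hj0⟩ := hgap (n1 + m) (by omega)
  set n := n1 + m + 2 * j0
  obtain ⟨l, hl⟩ : ∃ l, p * (2 * (P + 3)) = l + 1 :=
    ⟨p * (2 * (P + 3)) - 1, (Nat.sub_add_cancel (Nat.mul_pos hp (by omega))).symm⟩
  have hl' : 2 * P + 4 ≤ l := by nlinarith
  have heven : Even (l + 1) := hl ▸ ⟨p * (P + 3), by ring⟩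
  have hper' : ∀ i, n < i → k (i + (l + 1)) = k i := fun i hi => by
    rw [← hl, eq_add_mul_of_periodic hper (by omega)]
  obtain ⟨t, s, ht, hts, hrec⟩ := exists_wlen_recurrence hpos hj0 hper' heven
    (reach_all hpos hgap (by omega) hl' 0 0)
  have key : ∀ a, ∀ᶠ j in atTop, c ^ wlen k (n + (l + 1) * j) a = 1 := by
    intro a
    refine eventually_pow_eq_one ht hts (fun j => wlen_pos k _ a) (hrec a) hc ?_
    rw [Metric.tendsto_atTop]
    intro ε hε
    obtain ⟨N, hN⟩ := h (ε / 2) (by positivity)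
    refine ⟨N, fun j hj => ?_⟩
    rw [Real.dist_eq, sub_zero, abs_norm]
    exact (hN _ (by nlinarith) a).trans_lt (by linarith)
  obtain ⟨j, hj⟩ := (eventually_all.2 key).exists
  exact eq_one_of_pow_wlen_eq_one hpos _ hj

end WeakMixing

/-- for an eventually periodic sequence of positive integers satisfying
(★), the subshift is uniquely ergodic and weakly mixing: any μ-measurable eigenfunction
`f` (not a.e. 0, with `f ∘ σ = c·f` a.e.) is a.e. constant, and consequently `c = 1`. -/
theorem statement11 (k : ℕ → ℕ) (hpos : ∀ i, 1 ≤ i → 1 ≤ k i) (hstar : StarCond k)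
    (hper : ∃ m p : ℕ, 1 ≤ p ∧ ∀ i, m ≤ i → k (i + p) = k i)
    (ρ : ℕ → Fin 3) (hρ : ∀ n : ℕ, IsPrefixSeq (compApply k n [2]) ρ) :
    (∃! μ : Measure (ℕ → Fin 3), IsInvProb (orbitClosure ρ) μ) ∧
    ∀ μ : Measure (ℕ → Fin 3), IsInvProb (orbitClosure ρ) μ →
      ∀ (f : (ℕ → Fin 3) → ℂ) (c : ℂ), AEMeasurable f μ → ¬ f =ᵐ[μ] 0 →
        (fun x => f (shift x)) =ᵐ[μ] (fun x => c * f x) →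
        (∃ d : ℂ, f =ᵐ[μ] fun _ => d) ∧ c = 1 := by
  obtain ⟨m, p, hp, hper⟩ := hper
  have hgap := exists_gap hstar hp hper
  obtain ⟨B, hB⟩ := exists_bound_of_periodic hp hper
  have hq : ∀ n ≥ m, ∀ a b, Reach k n (2 * p + 4) b a := fun n hn a b =>
    reach_all hpos hgap hn le_rfl a b
  have hlen := eventually_le_wlen hpos hq
  obtain ⟨K, hK⟩ := exists_wlen_add_le hB hq (2 * p + 4)
  obtain ⟨K', hK'⟩ := exists_wlen_add_le hB hq (2 * p + 4 + 2)
  have hq' : ∀ n ≥ m + (2 * p + 4), ∀ a b, Reach k n (2 * p + 4) b a := fun n hn =>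
    hq n (by omega)
  have huniq := exists_isUniqueInvProb hρ hlen hq' hK
  refine ⟨huniq, fun μ hμ f c hf hf0 hfc => ?_⟩
  have herg := hμ.ergodic fun ν hν => huniq.unique hν hμ
  have hc : c = 1 := eigenvalue_eq_one hpos hp hper hgap (norm_eigenvalue_eq_one hμ hf hf0 hfc)
    fun ε hε => pow_wlen_near_one hμ herg hρ hlen hq' hK' hf hf0 hfc hε
  refine ⟨?_, hc⟩
  subst hc
  simp only [one_mul] at hfc
  exact herg.ae_eq_const_of_ae_eq_comp_ae hf.aestronglyMeasurable hfc
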